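/- Let X ⊂ A^n over Q̄ be an integral closed affine subvariety of dimension m ≤ n−2 and degree d, with projective closure X̄ ⊂ P^n and hyperplane section X_0 = X̄ ∩ H_0 where H_0 = {x_0 = 0}. Then there exist an (m+1)×n integer matrix A and an integer vector b ∈ Z^{m+1}, all entries of size O_{n,d}(1), such that π: X → A^{m+1}, x ↦ Ax + b, is birational onto its image; moreover its fibres have at most d points, π(X) is an integral hypersurface of degree d in A^{m+1}, and the induced map on X̄ restricts to a birational morphism on each irreducible component X_{0,i} of X_0, so that π̄(X̄) ∩ H_0 = ∪_i π̄(X_{0,i}) with each π̄(X_{0,i}) integral of dimension m−1 and degree deg X_{0,i}. -/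

import Mathlib

open MvPolynomial

noncomputable section

/-- The zero locus in `K^n` of a set of polynomials. -/
def zeroLocusSet {K : Type*} [Field K] {n : ℕ} (S : Set (MvPolynomial (Fin n) K)) :
    Set (Fin n → K) := {x | ∀ f ∈ S, eval x f = 0}

/-- The vanishing ideal of a set of points of `K^n`. -/
def vIdeal {K : Type*} [Field K] {n : ℕ} (S : Set (Fin n → K)) :
    Ideal (MvPolynomial (Fin n) K) where
  carrier := {f | ∀ x ∈ S, eval x f = 0}
  add_mem' := by intro a b ha hb x hx; simp [ha x hx, hb x hx]
  zero_mem' := by intro x hx; simp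
  smul_mem' := by intro c f hf x hx; simp [smul_eq_mul, hf x hx]

/-- Dimension of (the Zariski closure of) a subset of `K^n`, as the Krull
dimension of its affine coordinate ring. -/
def coneDim {K : Type*} [Field K] {n : ℕ} (S : Set (Fin n → K)) : WithBot ℕ∞ :=
  ringKrullDim (MvPolynomial (Fin n) K ⧸ vIdeal S)

/-- An `r×r` minor of the Jacobian matrix of a system of `r` polynomials,
given by a choice `c` of `r` columns. -/
def jacMinor {K : Type*} [Field K] {n r : ℕ} (f : Fin r → MvPolynomial (Fin n) K)
    (c : Fin r → Fin n) : MvPolynomial (Fin n) K :=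
  (Matrix.of fun i j => pderiv (c j) (f i)).det

/-- The ideal of the singular locus (Jacobian criterion) of the system `f`. -/
def singIdeal {K : Type*} [Field K] {n r : ℕ} (f : Fin r → MvPolynomial (Fin n) K) :
    Ideal (MvPolynomial (Fin n) K) :=
  Ideal.span (Set.range f ∪ Set.range (jacMinor f))

/-- The projective scheme cut out by the system `f` is non-singular: any prime
containing the singular ideal contains the irrelevant ideal. -/
def ProjNonsingular {K : Type*} [Field K] {n r : ℕ} (f : Fin r → MvPolynomial (Fin n) K) :
    Prop :=
  ∀ P : Ideal (MvPolynomial (Fin n) K), P.IsPrime → singIdeal f ≤ P →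
    ∀ i, MvPolynomial.X i ∈ P

/-- The directional derivative polynomial `G^y = y · ∇G`. -/
def polY {K : Type*} [Field K] {n : ℕ} (y : Fin n → K) (G : MvPolynomial (Fin n) K) :
    MvPolynomial (Fin n) K :=
  ∑ i, C (y i) * pderiv i G

end

noncomputable section

/-- A set is an (affine) subvariety if it is the zero locus of its vanishing ideal. -/
def IsSubvariety {K : Type*} [Field K] {n : ℕ} (S : Set (Fin n → K)) : Prop :=
  S = zeroLocusSet (↑(vIdeal S) : Set (MvPolynomial (Fin n) K))

/-- `Z` is an irreducible component of `X`. -/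
def IrredComp {K : Type*} [Field K] {n : ℕ} (X Z : Set (Fin n → K)) : Prop :=
  Z ⊆ X ∧ IsSubvariety Z ∧ Z.Nonempty ∧ (vIdeal Z).IsPrime ∧
    ∀ Z' : Set (Fin n → K), Z' ⊆ X → IsSubvariety Z' → (vIdeal Z').IsPrime →
      Z ⊆ Z' → Z = Z'

/-- `X` is equidimensional of dimension `m`. -/
def Equidim {K : Type*} [Field K] {n : ℕ} (X : Set (Fin n → K)) (m : ℕ) : Prop :=
  ∀ Z : Set (Fin n → K), IrredComp X Z → coneDim Z = (m : WithBot ℕ∞)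

/-- The set of lines (1-dimensional subspaces) contained in `S ∪ {0}`; these are the
projective points of the cone `S`. -/
def linesIn {K : Type*} [Field K] {N : ℕ} (S : Set (Fin N → K)) :
    Set (Submodule K (Fin N → K)) :=
  {L | Module.finrank K L = 1 ∧ (L : Set (Fin N → K)) ⊆ S ∪ {0}}

/-- The cone `S` (representing a projective variety) has degree `d`: every linear
section of it which is finite (projectively) has at most `d` points, and some finite
linear section has exactly `d` points. -/
def HasDeg {K : Type*} [Field K] {N : ℕ} (S : Set (Fin N → K)) (d : ℕ) : Prop :=
  (∀ U : Submodule K (Fin N → K),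
      (linesIn (S ∩ ↑U)).Finite → (linesIn (S ∩ ↑U)).ncard ≤ d) ∧
  (∃ U : Submodule K (Fin N → K),
      (linesIn (S ∩ ↑U)).Finite ∧ (linesIn (S ∩ ↑U)).ncard = d)

/-- The union of all the linear spaces `M ⊇ W` with `dim M = dim W + 1` which meet the
cone `Z` in at least two distinct projective points.  If `S_{Λ,Z}` (for `Λ = P(W)`)
has projective dimension `s`, this cone has dimension `s + 1 + finrank W`. -/
def SCset {K : Type*} [Field K] {N : ℕ} (Z : Set (Fin N → K))
    (W : Submodule K (Fin N → K)) : Set (Fin N → K) :=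
  ↑W ∪ {v | ∃ x y : Fin N → K, x ∈ Z ∧ y ∈ Z ∧
    x ∈ W ⊔ Submodule.span K {v} ∧ y ∈ W ⊔ Submodule.span K {v} ∧
    LinearIndependent K ![x, y]}

end

noncomputable section

/-- The affine cone in `k^{n+1}` over (the projective points of) an affine set
`X ⊆ k^n`, via `x ↦ (1 : x)`. -/
def coneOf {k : Type*} [Field k] {n : ℕ} (X : Set (Fin n → k)) :
    Set (Fin (n + 1) → k) :=
  {v | ∃ (c : k) (x : Fin n → k), x ∈ X ∧ v = c • (Fin.cons (1 : k) x : Fin (n + 1) → k)}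

/-- The (cone over the) projective closure of an affine set `X ⊆ k^n`. -/
def projClosure {k : Type*} [Field k] {n : ℕ} (X : Set (Fin n → k)) :
    Set (Fin (n + 1) → k) :=
  zeroLocusSet (↑(vIdeal (coneOf X)) : Set (MvPolynomial (Fin (n + 1)) k))

/-- The affine set `X ⊆ k^n` has degree `d` (the degree of its projective closure). -/
def HasDegAff {k : Type*} [Field k] {n : ℕ} (X : Set (Fin n → k)) (d : ℕ) : Prop :=
  HasDeg (projClosure X) d

/-- The affine-linear map `x ↦ A x + b` with integer matrix `A` and vector `b`. -/
def affProj {k : Type*} [Field k] {n p : ℕ} (A : Matrix (Fin p) (Fin n) ℤ)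
    (b : Fin p → ℤ) (x : Fin n → k) : Fin p → k :=
  fun i => (∑ j, (A i j : k) * x j) + (b i : k)

/-- The projectivization `(x_0 : x) ↦ (x_0 : A x + x_0 b)` of the affine-linear map
`x ↦ A x + b`, acting on cones. -/
def projProj {k : Type*} [Field k] {n p : ℕ} (A : Matrix (Fin p) (Fin n) ℤ)
    (b : Fin p → ℤ) (v : Fin (n + 1) → k) : Fin (p + 1) → k :=
  Fin.cons (v 0) (fun i => (∑ j, (A i j : k) * v j.succ) + (b i : k) * v 0)

section IntegralExtensions

open scoped nonZeroDivisors IntermediateField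

/-- A homomorphism into an algebraically closed field extends along an integral homomorphism
whose kernel it kills. -/
theorem exists_ringHom_comp_eq_of_isIntegral {A S K : Type*} [CommRing A] [CommRing S] [Field K]
    [IsAlgClosed K] (φ : A →+* S) (hφ : φ.IsIntegral) (χ : A →+* K)
    (hker : RingHom.ker φ ≤ RingHom.ker χ) : ∃ ψ : S →+* K, ψ.comp φ = χ := by
  let := φ.toAlgebra
  have : Algebra.IsIntegral A S := ⟨hφ⟩
  have : (RingHom.ker χ).IsPrime := RingHom.ker_isPrime χ
  obtain ⟨Q, -, hQ, hQc⟩ := Ideal.exists_ideal_over_prime_of_isIntegral (S := S) (RingHom.ker χ) ⊥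
    (by rw [← RingHom.ker_eq_comap_bot]; exact hker)
  have : Q.LiesOver (RingHom.ker χ) := ⟨hQc.symm⟩
  let : Algebra (A ⧸ RingHom.ker χ) K := (RingHom.kerLift χ).toAlgebra
  have : Module.IsTorsionFree (A ⧸ RingHom.ker χ) K :=
    Module.isTorsionFree_iff_algebraMap_injective.2 (RingHom.kerLift_injective χ)
  have : Module.IsTorsionFree (A ⧸ RingHom.ker χ) (S ⧸ Q) := by
    refine Module.isTorsionFree_iff_algebraMap_injective.2 ((injective_iff_map_eq_zero _).2 ?_)
    intro x hx
    obtain ⟨a, rfl⟩ := Ideal.Quotient.mk_surjective x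
    rw [Ideal.Quotient.eq_zero_iff_mem, ← hQc]
    change algebraMap A S a ∈ Q
    exact Ideal.Quotient.eq_zero_iff_mem.1
      (show Ideal.Quotient.mk Q (algebraMap A S a) = 0 from hx)
  let g : (S ⧸ Q) →ₐ[A ⧸ RingHom.ker χ] K := IsAlgClosed.lift
  refine ⟨g.toRingHom.comp (Ideal.Quotient.mk Q), ?_⟩
  ext a
  have h := g.commutes (Ideal.Quotient.mk _ a)
  exact h

variable {R S : Type*} [CommRing R] [CommRing S] [IsDomain S] [Algebra R S]
  [FaithfulSMul R S] [IsIntegrallyClosed R]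

theorem ringKrullDim_eq_of_isIntegral [Algebra.IsIntegral R S] :
    ringKrullDim S = ringKrullDim R := by
  apply le_antisymm
  · refine Order.krullDim_le_of_strictMono (PrimeSpectrum.comap (algebraMap R S)) ?_
    intro I J hIJ
    exact Ideal.IsIntegral.comap_lt_comap (R := R) hIJ
  · refine iSup_le fun l => ?_
    obtain ⟨P, hP, hPl⟩ := Ideal.exists_ideal_over_prime_of_isIntegral (S := S) l.last.asIdeal ⊥
      (by
        intro x hx
        have : algebraMap R S x = 0 := by simpa using hx
        rw [(FaithfulSMul.algebraMap_injective R S) (this.trans (map_zero _).symm)]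
        exact zero_mem _)
    have : P.IsPrime := hPl.1
    have : P.LiesOver l.last.asIdeal := ⟨hPl.2.symm⟩
    obtain ⟨L, hL, -⟩ := Ideal.exists_ltSeries_of_hasGoingDown (S := S) l P
    rw [← hL]
    exact le_iSup (fun l : LTSeries (PrimeSpectrum S) => ((l.length : ℕ) : WithBot ℕ∞)) L

variable [IsDomain R]

theorem linearIndependent_pow_minpoly {s : S} (hs : IsIntegral R s) :
    LinearIndependent R fun i : Fin (minpoly R s).natDegree => s ^ (i : ℕ) := by
  rw [Fintype.linearIndependent_iff]
  intro g hg
  set p : Polynomial R := ∑ i : Fin (minpoly R s).natDegree, Polynomial.monomial (i : ℕ) (g i)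
    with hp
  have hroot : Polynomial.aeval s p = 0 := by
    simpa [hp, Polynomial.aeval_monomial, Algebra.smul_def] using hg
  have hdvd := minpoly.isIntegrallyClosed_dvd hs hroot
  have hdeg : p.degree < (minpoly R s).degree := by
    rw [Polynomial.degree_eq_natDegree (minpoly.ne_zero hs)]
    refine lt_of_le_of_lt (Polynomial.degree_sum_le _ _) ?_
    rw [Finset.sup_lt_iff (by simp [bot_lt_iff_ne_bot])]
    intro i _
    refine lt_of_le_of_lt (Polynomial.degree_monomial_le _ _) ?_
    exact_mod_cast i.2
  have hp0 : p = 0 := Polynomial.eq_zero_of_dvd_of_degree_lt hdvd hdeg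
  intro i
  have := congrArg (fun q => Polynomial.coeff q (i : ℕ)) hp0
  simpa [hp, Polynomial.finsetSum_coeff, Polynomial.coeff_monomial, Fin.val_inj] using this

theorem eq_zero_of_sum_smul_pow_minpoly {s : S} (hs : IsIntegral R s)
    (g : Fin (minpoly R s).natDegree → R) (hg : ∑ i, g i • s ^ (i : ℕ) = 0) : g = 0 := by
  have hpow := linearIndependent_pow_minpoly hs
  exact funext (Fintype.linearIndependent_iff.1 hpow g hg)

variable [Module.Finite R S]

theorem natDegree_minpoly_le_finrank (s : S) :
    (minpoly R s).natDegree ≤ Module.finrank R S := by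
  simpa using (linearIndependent_pow_minpoly (Algebra.IsIntegral.isIntegral (R := R) s)
    ).fintype_card_le_finrank

/-- If `z` has the largest possible degree over `R`, then every element of `S` is, up to a
denominator in `R`, a polynomial in `z`. -/
theorem exists_smul_eq_aeval_of_natDegree_minpoly_eq {z : S}
    (hz : (minpoly R z).natDegree = Module.finrank R S) (s : S) :
    ∃ D : R, D ≠ 0 ∧ ∃ G : Polynomial R, D • s = Polynomial.aeval z G := by
  have hpow := linearIndependent_pow_minpoly (Algebra.IsIntegral.isIntegral (R := R) z)
  have hdep : ¬ LinearIndependent R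
      (Fin.cons s fun i : Fin (minpoly R z).natDegree => z ^ (i : ℕ) :
        Fin ((minpoly R z).natDegree + 1) → S) := by
    intro h
    have := h.fintype_card_le_finrank
    simp [hz] at this
  rw [Fintype.linearIndependent_iff] at hdep
  push Not at hdep
  obtain ⟨g, hg, i, hi⟩ := hdep
  rw [Fin.sum_univ_succ] at hg
  simp only [Fin.cons_zero, Fin.cons_succ] at hg
  refine ⟨g 0, ?_, -∑ i : Fin (minpoly R z).natDegree, Polynomial.monomial (i : ℕ) (g i.succ), ?_⟩
  · intro h0
    rw [h0, zero_smul, zero_add] at hg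
    have h1 := Fintype.linearIndependent_iff.1 hpow _ hg
    refine Fin.cases (fun hi => hi h0) (fun j hj => hj (h1 j)) i hi
  · rw [eq_neg_of_add_eq_zero_left hg]
    simp [Polynomial.aeval_monomial, Algebra.smul_def]

/-- A primitive element inside `S`, together with a resultant-type identity
expressing separability of its minimal polynomial. -/
theorem exists_minpoly_natDegree_eq_finrank [CharZero R] :
    ∃ w : S, (minpoly R w).natDegree = Module.finrank R S ∧
      ∃ c : R, c ≠ 0 ∧ ∃ a b : Polynomial R,
        a * minpoly R w + b * Polynomial.derivative (minpoly R w) = Polynomial.C c := by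
  let F := FractionRing R
  let E := FractionRing S
  let : Algebra F E := FractionRing.liftAlgebra R E
  have : IsScalarTower R F E := FractionRing.isScalarTower_liftAlgebra R E
  have hfr : Module.finrank F E = Module.finrank R S := IsFractionRing.finrank_eq R F S E
  have : FiniteDimensional F E := by
    apply Module.finite_of_finrank_pos
    rw [hfr]
    simpa using (linearIndependent_pow_minpoly (R := R) (S := S)
      (isIntegral_one)).fintype_card_le_finrank.trans_lt' (by
        simpa using minpoly.natDegree_pos (isIntegral_one (R := R) (B := S)))
  have : CharZero F := charZero_of_injective_algebraMap (IsFractionRing.injective R F)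
  obtain ⟨α, hα⟩ := Field.exists_primitive_element F E
  obtain ⟨⟨w, ⟨_, t, ht, rfl⟩⟩, hw⟩ := IsLocalization.surj (Algebra.algebraMapSubmonoid S R⁰) α
  have ht0 : algebraMap R F t ≠ 0 := by
    simpa using nonZeroDivisors.ne_zero ht
  have hw' : algebraMap S E w = algebraMap R F t • α := by
    rw [← hw, Algebra.smul_def, mul_comm, ← IsScalarTower.algebraMap_apply,
      ← IsScalarTower.algebraMap_apply]
  have hint : IsIntegral R w := Algebra.IsIntegral.isIntegral w
  have hprim : F⟮algebraMap S E w⟯ = ⊤ := by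
    rw [eq_top_iff, ← hα, IntermediateField.adjoin_simple_le_iff]
    have h1 : algebraMap S E w ∈ F⟮algebraMap S E w⟯ := IntermediateField.mem_adjoin_simple_self _ _
    have h2 := F⟮algebraMap S E w⟯.smul_mem h1 (x := (algebraMap R F t)⁻¹)
    rwa [hw', smul_smul, inv_mul_cancel₀ ht0, one_smul, ← hw'] at h2
  have hmin := minpoly.isIntegrallyClosed_eq_field_fractions F E hint
  refine ⟨w, ?_, ?_⟩
  · rw [Field.primitive_element_iff_minpoly_natDegree_eq, hmin, (minpoly.monic hint).natDegree_map,
      hfr] at hprim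
    exact hprim
  · have hsep : (minpoly F (algebraMap S E w)).Separable :=
      (minpoly.irreducible (IsIntegral.of_finite F _)).separable
    obtain ⟨a, b, hab⟩ := hsep
    obtain ⟨ca, hca0, hca⟩ := IsLocalization.integerNormalization_spec R⁰ a
    obtain ⟨cb, hcb0, hcb⟩ := IsLocalization.integerNormalization_spec R⁰ b
    refine ⟨ca * cb, mul_ne_zero (nonZeroDivisors.ne_zero hca0) (nonZeroDivisors.ne_zero hcb0),
      Polynomial.C cb * IsLocalization.integerNormalization R⁰ a,
      Polynomial.C ca * IsLocalization.integerNormalization R⁰ b, ?_⟩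
    apply Polynomial.map_injective (algebraMap R F) (IsFractionRing.injective R F)
    have key := congrArg (fun q => Polynomial.C (algebraMap R F (ca * cb)) * q) hab
    simp only [Polynomial.map_add, Polynomial.map_mul, Polynomial.map_C, hca, hcb,
      ← Polynomial.derivative_map, ← hmin]
    simp only [mul_one, map_mul, Algebra.smul_def, Polynomial.algebraMap_apply] at key ⊢
    rw [← key]
    ring
end IntegralExtensions

section PolynomialFunctions

variable {K : Type*} [Field K] {N r s : ℕ}

theorem mem_vIdeal {S : Set (Fin N → K)} {f : MvPolynomial (Fin N) K} :
    f ∈ vIdeal S ↔ ∀ x ∈ S, eval x f = 0 := Iff.rfl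

theorem mem_zeroLocusSet {S : Set (MvPolynomial (Fin N) K)} {x : Fin N → K} :
    x ∈ zeroLocusSet S ↔ ∀ f ∈ S, eval x f = 0 := Iff.rfl

theorem vIdeal_anti {S T : Set (Fin N → K)} (h : S ⊆ T) : vIdeal T ≤ vIdeal S :=
  fun _ hf x hx => hf x (h hx)

theorem vIdeal_eq_vanishingIdeal (S : Set (Fin N → K)) : vIdeal S = vanishingIdeal K S := by
  ext f
  simp [mem_vIdeal, mem_vanishingIdeal_iff]

theorem zeroLocusSet_eq_zeroLocus (I : Ideal (MvPolynomial (Fin N) K)) :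
    zeroLocusSet (I : Set (MvPolynomial (Fin N) K)) = zeroLocus K I := by
  ext x
  simp [mem_zeroLocusSet, mem_zeroLocus_iff]

theorem subset_zeroLocusSet_vIdeal (S : Set (Fin N → K)) :
    S ⊆ zeroLocusSet (vIdeal S : Set (MvPolynomial (Fin N) K)) :=
  fun x hx _ hf => hf x hx

theorem vIdeal_zeroLocusSet_vIdeal (S : Set (Fin N → K)) :
    vIdeal (zeroLocusSet (vIdeal S : Set (MvPolynomial (Fin N) K))) = vIdeal S :=
  le_antisymm (vIdeal_anti (subset_zeroLocusSet_vIdeal S)) fun f hf _ hx => hx f hf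

theorem isSubvariety_zeroLocusSet (T : Set (MvPolynomial (Fin N) K)) :
    IsSubvariety (zeroLocusSet T) :=
  (subset_zeroLocusSet_vIdeal _).antisymm fun _ hx f hf => hx f fun _ hy => hy f hf

theorem isSubvariety_of_subset {S : Set (Fin N → K)}
    (h : zeroLocusSet (vIdeal S : Set (MvPolynomial (Fin N) K)) ⊆ S) : IsSubvariety S :=
  (subset_zeroLocusSet_vIdeal _).antisymm h

theorem IsSubvariety.mem {S : Set (Fin N → K)} (hS : IsSubvariety S) {x : Fin N → K}
    (hx : ∀ f ∈ vIdeal S, eval x f = 0) : x ∈ S := by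
  rw [hS]
  exact hx

theorem IsSubvariety.inter {S T : Set (Fin N → K)} (hS : IsSubvariety S) (hT : IsSubvariety T) :
    IsSubvariety (S ∩ T) :=
  isSubvariety_of_subset fun _ hx =>
    ⟨hS.mem fun f hf => hx f (vIdeal_anti Set.inter_subset_left hf),
      hT.mem fun f hf => hx f (vIdeal_anti Set.inter_subset_right hf)⟩

theorem isSubvariety_setOf_eval (f : MvPolynomial (Fin N) K) :
    IsSubvariety {x | eval x f = 0} := by
  have : {x | eval x f = 0} = zeroLocusSet {f} := by ext; simp [mem_zeroLocusSet]
  rw [this]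
  exact isSubvariety_zeroLocusSet _

theorem IsSubvariety.eq_of_vIdeal_eq {S T : Set (Fin N → K)} (hS : IsSubvariety S)
    (hT : IsSubvariety T) (h : vIdeal S = vIdeal T) : S = T := by
  rw [hS, hT, h]

/-- The polynomial of degree one attached to a linear form. -/
def linPoly (l : (Fin N → K) →ₗ[K] K) : MvPolynomial (Fin N) K :=
  ∑ j, C (l (Pi.single j 1)) * X j

theorem eval_linPoly (l : (Fin N → K) →ₗ[K] K) (v : Fin N → K) : eval v (linPoly l) = l v := by
  conv_rhs => rw [← Finset.univ_sum_single v, map_sum]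
  simp only [linPoly, map_sum, map_mul, eval_C, eval_X]
  refine Finset.sum_congr rfl fun j _ => ?_
  have : (Pi.single j (v j) : Fin N → K) = v j • Pi.single j 1 := by
    rw [← Pi.single_smul, smul_eq_mul, mul_one]
  rw [this, map_smul, smul_eq_mul, mul_comm]

theorem isHomogeneous_linPoly (l : (Fin N → K) →ₗ[K] K) : (linPoly l).IsHomogeneous 1 :=
  IsHomogeneous.sum _ _ _ fun _ _ => isHomogeneous_C_mul_X _ _

/-- Pull-back of polynomials along a linear map. -/
def pullback (L : (Fin N → K) →ₗ[K] (Fin r → K)) :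
    MvPolynomial (Fin r) K →ₐ[K] MvPolynomial (Fin N) K :=
  aeval fun i => linPoly (LinearMap.proj i ∘ₗ L)

theorem pullback_X (L : (Fin N → K) →ₗ[K] (Fin r → K)) (i : Fin r) :
    pullback L (X i) = linPoly (LinearMap.proj i ∘ₗ L) := by
  simp [pullback]

@[simp]
theorem eval_pullback (L : (Fin N → K) →ₗ[K] (Fin r → K)) (f : MvPolynomial (Fin r) K)
    (v : Fin N → K) : eval v (pullback L f) = eval (L v) f := by
  induction f using MvPolynomial.induction_on with
  | C a => simp [pullback]
  | add p q hp hq => simp [hp, hq]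
  | mul_X p i hp => simp [hp, pullback_X, eval_linPoly]

theorem isHomogeneous_pullback {f : MvPolynomial (Fin r) K} {k : ℕ} (hf : f.IsHomogeneous k)
    (L : (Fin N → K) →ₗ[K] (Fin r → K)) : (pullback L f).IsHomogeneous k := by
  have h := hf.aeval (fun i => linPoly (LinearMap.proj i ∘ₗ L)) fun i => isHomogeneous_linPoly _
  rwa [one_mul] at h

theorem totalDegree_pullback_le (L : (Fin N → K) →ₗ[K] (Fin r → K)) (f : MvPolynomial (Fin r) K) :
    (pullback L f).totalDegree ≤ f.totalDegree := by
  conv_lhs => rw [← sum_homogeneousComponent f, map_sum]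
  refine totalDegree_finsetSum_le fun i hi => ?_
  refine (isHomogeneous_pullback (homogeneousComponent_isHomogeneous i f) L).totalDegree_le.trans ?_
  simpa [Nat.lt_succ_iff] using hi

theorem eval_smul_of_isHomogeneous {f : MvPolynomial (Fin N) K} {k : ℕ} (hf : f.IsHomogeneous k)
    (t : K) (v : Fin N → K) : eval (t • v) f = t ^ k * eval v f := by
  rw [eval_eq', eval_eq', Finset.mul_sum]
  refine Finset.sum_congr rfl fun d hd => ?_
  have h1 : ∑ i, d i = k := by
    have := hf.degree_eq_sum_deg_support hd
    rw [this, Finset.sum_subset (Finset.subset_univ d.support)]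
    intro i _ hi
    simpa using hi
  simp only [Pi.smul_apply, smul_eq_mul, mul_pow, Finset.prod_mul_distrib, Finset.prod_pow_eq_pow_sum,
    h1]
  ring

/-- Sets stable under scaling. -/
def IsCone (Z : Set (Fin N → K)) : Prop := ∀ (t : K), ∀ v ∈ Z, t • v ∈ Z

theorem homogeneousComponent_mem_vIdeal [Infinite K] {Z : Set (Fin N → K)} (hZ : IsCone Z)
    {f : MvPolynomial (Fin N) K} (hf : f ∈ vIdeal Z) (k : ℕ) :
    homogeneousComponent k f ∈ vIdeal Z := by
  intro v hv
  by_cases hk : f.totalDegree < k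
  · simp [homogeneousComponent_eq_zero _ _ hk]
  let p : Polynomial K := ∑ i ∈ Finset.range (f.totalDegree + 1),
    Polynomial.monomial i (eval v (homogeneousComponent i f))
  have hp : p = 0 := by
    refine Polynomial.funext fun t => ?_
    have h1 := hf (t • v) (hZ t v hv)
    rw [← sum_homogeneousComponent f, map_sum] at h1
    simp only [p, Polynomial.eval_finsetSum, Polynomial.eval_monomial, Polynomial.eval_zero]
    rw [← h1]
    refine Finset.sum_congr rfl fun i _ => ?_
    rw [eval_smul_of_isHomogeneous (homogeneousComponent_isHomogeneous i f), mul_comm]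
  have h2 := congrArg (fun q => Polynomial.coeff q k) hp
  simp only [p, Polynomial.finsetSum_coeff, Polynomial.coeff_monomial, Polynomial.coeff_zero] at h2
  rwa [Finset.sum_ite_eq', if_pos (by simp; omega)] at h2

theorem homogeneousComponent_mul_of_isHomogeneous {f g : MvPolynomial (Fin N) K} {j : ℕ}
    (hg : g.IsHomogeneous j) (i : ℕ) :
    homogeneousComponent (i + j) (f * g) = homogeneousComponent i f * g := by
  let : GradedAlgebra (homogeneousSubmodule (Fin N) K) := gradedAlgebra
  have h := DirectSum.coe_decompose_mul_add_of_right_mem (homogeneousSubmodule (Fin N) K) (i := i)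
    (a := f) ((mem_homogeneousSubmodule _ _).2 hg)
  have h1 : ∀ (φ : MvPolynomial (Fin N) K) (k : ℕ),
      (DirectSum.decompose (homogeneousSubmodule (Fin N) K) φ k : MvPolynomial (Fin N) K) =
        homogeneousComponent k φ := decomposition.decompose'_apply
  rwa [h1, h1] at h

theorem exists_eval_ne_zero [Infinite K] {f : MvPolynomial (Fin N) K} (hf : f ≠ 0) :
    ∃ x, eval x f ≠ 0 := by
  by_contra! h
  exact hf (MvPolynomial.funext fun x => by simp [h x])

end PolynomialFunctions

section LinearSystems

variable {K : Type*} [Field K] {N r s : ℕ}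

/-- The linear system `L` has no common zero on `Z` except the origin. -/
def NoetherOn (L : (Fin N → K) →ₗ[K] (Fin r → K)) (Z : Set (Fin N → K)) : Prop :=
  ∀ v ∈ Z, L v = 0 → v = 0

/-- The components of `L` are algebraically independent on `Z`. -/
def IndepOn (L : (Fin N → K) →ₗ[K] (Fin r → K)) (Z : Set (Fin N → K)) : Prop :=
  ∀ f : MvPolynomial (Fin r) K, (∀ v ∈ Z, eval (L v) f = 0) → f = 0

/-- The ring of polynomial functions on `Z`. -/
def CoordRing (Z : Set (Fin N → K)) : Type _ := MvPolynomial (Fin N) K ⧸ vIdeal Z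

instance (Z : Set (Fin N → K)) : CommRing (CoordRing Z) :=
  inferInstanceAs (CommRing (MvPolynomial (Fin N) K ⧸ vIdeal Z))

instance (Z : Set (Fin N → K)) : Algebra K (CoordRing Z) :=
  inferInstanceAs (Algebra K (MvPolynomial (Fin N) K ⧸ vIdeal Z))

/-- The restriction of a polynomial to `Z`. -/
def toFun (Z : Set (Fin N → K)) : MvPolynomial (Fin N) K →ₐ[K] CoordRing Z :=
  Ideal.Quotient.mkₐ K (vIdeal Z)

theorem toFun_surjective (Z : Set (Fin N → K)) : Function.Surjective (toFun Z) :=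
  Ideal.Quotient.mk_surjective

theorem toFun_eq_zero_iff {Z : Set (Fin N → K)} {f : MvPolynomial (Fin N) K} :
    toFun Z f = 0 ↔ f ∈ vIdeal Z :=
  Ideal.Quotient.eq_zero_iff_mem

theorem toFun_eq_iff {Z : Set (Fin N → K)} {f g : MvPolynomial (Fin N) K} :
    toFun Z f = toFun Z g ↔ ∀ v ∈ Z, eval v f = eval v g := by
  rw [← sub_eq_zero, ← map_sub, toFun_eq_zero_iff, mem_vIdeal]
  simp [sub_eq_zero]

theorem isDomain_coordRing {Z : Set (Fin N → K)} (hZ : (vIdeal Z).IsPrime) :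
    IsDomain (CoordRing Z) :=
  inferInstanceAs (IsDomain (MvPolynomial (Fin N) K ⧸ vIdeal Z))

/-- The ring homomorphism on coordinate rings attached to a linear map. -/
def toCoord (L : (Fin N → K) →ₗ[K] (Fin r → K)) (Z : Set (Fin N → K)) :
    MvPolynomial (Fin r) K →ₐ[K] CoordRing Z :=
  (toFun Z).comp (pullback L)

theorem toCoord_apply (L : (Fin N → K) →ₗ[K] (Fin r → K)) (Z : Set (Fin N → K))
    (f : MvPolynomial (Fin r) K) : toCoord L Z f = toFun Z (pullback L f) :=
  rfl

theorem IndepOn.injective {L : (Fin N → K) →ₗ[K] (Fin r → K)} {Z : Set (Fin N → K)}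
    (h : IndepOn L Z) : Function.Injective (toCoord L Z) := by
  refine (injective_iff_map_eq_zero _).2 fun f hf => h f fun v hv => ?_
  rw [toCoord_apply, toFun_eq_zero_iff] at hf
  simpa using hf v hv

/-- The coordinate ring of `Z` is finite over the polynomial ring, via `L`. -/
def FiniteOn (L : (Fin N → K) →ₗ[K] (Fin r → K)) (Z : Set (Fin N → K)) : Prop :=
  (toCoord L Z).toRingHom.Finite

/-- On a cone, a linear system without base points has the coordinate ring finite over it,
with control on degrees. -/
theorem NoetherOn.exists_generators [IsAlgClosed K] {L : (Fin N → K) →ₗ[K] (Fin r → K)}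
    {Z : Set (Fin N → K)} (hL : NoetherOn L Z) (hZ : IsCone Z) (hZc : IsSubvariety Z) :
    ∃ (k : ℕ) (B : Fin k → MvPolynomial (Fin N) K), ∀ f, ∃ q : Fin k → MvPolynomial (Fin r) K,
      (∀ i, (q i).totalDegree ≤ f.totalDegree) ∧
        ∀ v ∈ Z, eval v f = ∑ i, eval (L v) (q i) * eval v (B i) := by
  have hInf : Infinite K := IsAlgClosed.instInfinite
  let l : Fin r → MvPolynomial (Fin N) K := fun i => linPoly (LinearMap.proj i ∘ₗ L)
  let J := vIdeal Z ⊔ Ideal.span (Set.range l)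
  have hrad : ∀ j, (X j : MvPolynomial (Fin N) K) ∈ J.radical := by
    intro j
    rw [← vanishingIdeal_zeroLocus_eq_radical (K := K), mem_vanishingIdeal_iff]
    intro v hv
    have hvZ : v ∈ Z := hZc.mem fun f hf => by
      simpa using hv f (Ideal.mem_sup_left hf)
    have hLv : L v = 0 := by
      ext i
      have := hv (l i) (Ideal.mem_sup_right (Ideal.subset_span ⟨i, rfl⟩))
      simpa [l, eval_linPoly] using this
    simp [hL v hvZ hLv]
  choose e he using hrad
  let M := ∑ j, e j + 1
  have hM : ∀ j, ∃ h : Fin r → MvPolynomial (Fin N) K, (∀ i, (h i).totalDegree ≤ M - 1) ∧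
      ∀ v ∈ Z, v j ^ M = ∑ i, L v i * eval v (h i) := by
    intro j
    have h1 : (X j : MvPolynomial (Fin N) K) ^ M ∈ J :=
      Ideal.pow_mem_of_pow_mem J (he j)
        ((Finset.single_le_sum (f := e) (fun _ _ => Nat.zero_le _) (Finset.mem_univ j)).trans
          (Nat.le_succ _))
    obtain ⟨g, hg, y, hy, hgy⟩ := Submodule.mem_sup.1 h1
    obtain ⟨c, rfl⟩ := Ideal.mem_span_range_iff_exists_fun.1 hy
    refine ⟨fun i => homogeneousComponent (M - 1) (c i),
      fun i => (homogeneousComponent_isHomogeneous _ _).totalDegree_le, fun v hv => ?_⟩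
    have h2 := congrArg (homogeneousComponent M) hgy
    rw [map_add, map_sum, homogeneousComponent_eq_self (isHomogeneous_X_pow j M)] at h2
    have h3 := congrArg (eval v) h2
    rw [map_add, homogeneousComponent_mem_vIdeal hZ hg M v hv, zero_add, map_sum, map_pow,
      eval_X] at h3
    rw [← h3]
    refine Finset.sum_congr rfl fun i _ => ?_
    have h4 := homogeneousComponent_mul_of_isHomogeneous (f := c i)
      (isHomogeneous_linPoly (LinearMap.proj i ∘ₗ L)) (M - 1)
    rw [Nat.sub_add_cancel (by simp [M])] at h4
    rw [h4, map_mul, eval_linPoly, mul_comm]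
    rfl
  choose h hdeg hrel using hM
  let m : (Fin N → Fin M) → MvPolynomial (Fin N) K := fun β => ∏ j, X j ^ (β j : ℕ)
  let Q : ℕ → MvPolynomial (Fin N) K → Prop := fun t f =>
    ∃ q : (Fin N → Fin M) → MvPolynomial (Fin r) K, (∀ β, (q β).totalDegree ≤ t) ∧
      ∀ v ∈ Z, eval v f = ∑ β, eval (L v) (q β) * eval v (m β)
  have hadd : ∀ t f g, Q t f → Q t g → Q t (f + g) := by
    rintro t f g ⟨q, hq, hq'⟩ ⟨p, hp, hp'⟩
    refine ⟨q + p, fun β => (totalDegree_add _ _).trans (max_le (hq β) (hp β)), fun v hv => ?_⟩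
    simp [hq' v hv, hp' v hv, add_mul, Finset.sum_add_distrib]
  have hzero : ∀ t, Q t 0 := fun t => ⟨0, fun _ => by simp, fun v _ => by simp⟩
  have hsum : ∀ t {ι : Type} (s : Finset ι) (f : ι → MvPolynomial (Fin N) K),
      (∀ i ∈ s, Q t (f i)) → Q t (∑ i ∈ s, f i) := by
    intro t ι s f hf
    exact Finset.sum_induction f (Q t) (hadd t) (hzero t) hf
  have hCmul : ∀ t a f, Q t f → Q t (C a * f) := by
    rintro t a f ⟨q, hq, hq'⟩
    refine ⟨fun β => C a * q β, fun β => (totalDegree_mul _ _).trans (by simpa using hq β),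
      fun v hv => ?_⟩
    simp [hq' v hv, Finset.mul_sum, mul_assoc]
  have hlin : ∀ t i f, Q t f → Q (t + 1) (l i * f) := by
    rintro t i f ⟨q, hq, hq'⟩
    refine ⟨fun β => X i * q β, fun β => (totalDegree_mul _ _).trans ?_, fun v hv => ?_⟩
    · rw [totalDegree_X]
      linarith [hq β]
    · simp [hq' v hv, Finset.mul_sum, mul_assoc, l, eval_linPoly]
  have hcongr : ∀ t f g, (∀ v ∈ Z, eval v f = eval v g) → Q t f → Q t g := by
    rintro t f g hfg ⟨q, hq, hq'⟩
    exact ⟨q, hq, fun v hv => by rw [← hfg v hv, hq' v hv]⟩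
  have hmain : ∀ t f, f.totalDegree ≤ t → Q t f := by
    intro t
    induction t using Nat.strong_induction_on with
    | _ t ih =>
    intro f hf
    rw [f.as_sum]
    refine hsum t _ _ fun α hα => ?_
    have hαt : (∑ j, α j) ≤ t := by
      have := (le_totalDegree hα).trans hf
      rwa [Finsupp.sum_fintype _ _ (fun _ => rfl)] at this
    rw [← mul_one (coeff α f), ← C_mul_monomial]
    refine hCmul _ _ _ ?_
    by_cases hb : ∀ j, α j < M
    · refine ⟨fun β => if β = fun j => ⟨α j, hb j⟩ then 1 else 0, fun β => ?_, fun v _ => ?_⟩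
      · dsimp only
        split_ifs <;> simp
      · rw [Finset.sum_eq_single fun j => ⟨α j, hb j⟩]
        · simp [m, eval_monomial, Finsupp.prod_fintype]
        · intro b _ hb'
          simp [hb']
        · simp
    · push Not at hb
      obtain ⟨j, hj⟩ := hb
      have hM1 : 1 ≤ M := by simp [M]
      have hle : Finsupp.single j M ≤ α := by simpa using hj
      obtain ⟨γ, rfl⟩ := exists_add_of_le hle
      have hγ : M + ∑ i, γ i ≤ t := by
        simpa [Finset.sum_add_distrib, Finsupp.single_apply] using hαt
      obtain ⟨u, rfl⟩ : ∃ u, t = u + 1 := ⟨t - 1, by omega⟩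
      refine hcongr _ (∑ i, l i * (h j i * monomial γ 1)) _ (fun v hv => ?_) ?_
      · simp only [map_sum, map_mul, l, eval_linPoly, monomial_single_add, map_pow, eval_X,
          hrel j v hv, Finset.sum_mul]
        refine Finset.sum_congr rfl fun i _ => ?_
        rw [mul_assoc]
        rfl
      · refine hsum _ _ _ fun i _ => hlin _ _ _ (ih u (by omega) _ ?_)
        refine (totalDegree_mul _ _).trans ?_
        have h5 := hdeg j i
        have h6 : (monomial γ (1 : K)).totalDegree ≤ ∑ i, γ i := by
          rw [totalDegree_monomial _ one_ne_zero, Finsupp.sum_fintype _ _ (fun _ => rfl)]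
        omega
  let ε := Fintype.equivFin (Fin N → Fin M)
  refine ⟨_, fun i => m (ε.symm i), fun f => ?_⟩
  obtain ⟨q, hq, hq'⟩ := hmain _ f le_rfl
  refine ⟨fun i => q (ε.symm i), fun i => hq _, fun v hv => ?_⟩
  rw [hq' v hv, ← ε.symm.sum_comp]

theorem finiteOn_of_generators {L : (Fin N → K) →ₗ[K] (Fin r → K)} {Z : Set (Fin N → K)} {k : ℕ}
    (B : Fin k → MvPolynomial (Fin N) K) (hB : ∀ f, ∃ q : Fin k → MvPolynomial (Fin r) K,
      ∀ v ∈ Z, eval v f = ∑ i, eval (L v) (q i) * eval v (B i)) : FiniteOn L Z := by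
  let := (toCoord L Z).toRingHom.toAlgebra
  refine ⟨⟨(Set.finite_range fun i => toFun Z (B i)).toFinset, ?_⟩⟩
  rw [eq_top_iff]
  rintro x -
  obtain ⟨f, rfl⟩ := toFun_surjective Z x
  obtain ⟨q, hq⟩ := hB f
  have : toFun Z f = ∑ i, q i • toFun Z (B i) := by
    have h1 : ∀ i, q i • toFun Z (B i) = toFun Z (pullback L (q i) * B i) := fun i => by
      rw [map_mul]
      rfl
    simp only [h1, ← map_sum]
    rw [toFun_eq_iff]
    intro v hv
    simp [hq v hv]
  rw [this]
  exact Submodule.sum_mem _ fun i _ => Submodule.smul_mem _ _ (Submodule.subset_span (by simp))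

theorem NoetherOn.finiteOn [IsAlgClosed K] {L : (Fin N → K) →ₗ[K] (Fin r → K)}
    {Z : Set (Fin N → K)} (hL : NoetherOn L Z) (hZ : IsCone Z) (hZc : IsSubvariety Z) :
    FiniteOn L Z := by
  obtain ⟨k, B, hB⟩ := hL.exists_generators hZ hZc
  exact finiteOn_of_generators B fun f => (hB f).imp fun q hq => hq.2

end LinearSystems

section Moment

variable {K : Type*} [Field K] {n : ℕ}

/-- The linear form with coefficients `1, t, t², …`. -/
def momentForm (K : Type*) [Field K] (n t : ℕ) : (Fin n → K) →ₗ[K] K :=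
  ∑ j : Fin n, ((t ^ (j : ℕ) : ℕ) : K) • LinearMap.proj j

theorem momentForm_apply (t : ℕ) (v : Fin n → K) :
    momentForm K n t v = ∑ j : Fin n, ((t ^ (j : ℕ) : ℕ) : K) * v j := by
  simp [momentForm]

variable [CharZero K]

theorem exists_momentForm_ne_zero {s : Set (Fin n → K)} (hfin : s.Finite) (hs : ∀ v ∈ s, v ≠ 0)
    {k : ℕ} (hk : s.ncard ≤ k) : ∃ t ≤ k * n, ∀ v ∈ s, momentForm K n t v ≠ 0 := by
  let p : (Fin n → K) → Polynomial K := fun v => ∑ j : Fin n, Polynomial.monomial (j : ℕ) (v j)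
  have hp : ∀ v, v ≠ 0 → p v ≠ 0 := by
    intro v hv h0
    refine hv (funext fun j => ?_)
    have := congrArg (fun q => Polynomial.coeff q (j : ℕ)) h0
    simpa [p, Polynomial.finsetSum_coeff, Polynomial.coeff_monomial, Fin.val_inj] using this
  have hpe : ∀ (t : ℕ) v, (p v).eval (t : K) = momentForm K n t v := by
    intro t v
    simp only [p, Polynomial.eval_finsetSum, Polynomial.eval_monomial, momentForm_apply]
    exact Finset.sum_congr rfl fun j _ => by push_cast; ring
  have hpd : ∀ v, (p v).natDegree ≤ n := by
    intro v
    refine Polynomial.natDegree_sum_le_of_forall_le _ _ fun j _ => ?_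
    exact (Polynomial.natDegree_monomial_le _).trans j.2.le
  let Q : Polynomial K := ∏ v ∈ hfin.toFinset, p v
  have hQ : Q ≠ 0 := Finset.prod_ne_zero_iff.2 fun v hv => hp v (hs v (by simpa using hv))
  have hQd : Q.natDegree ≤ k * n := by
    refine (Polynomial.natDegree_prod_le _ _).trans ?_
    refine (Finset.sum_le_card_nsmul _ _ n fun v _ => hpd v).trans ?_
    rw [smul_eq_mul, ← Set.ncard_eq_toFinset_card s hfin]
    exact Nat.mul_le_mul_right _ hk
  by_contra! hcon
  classical
  have hsub : (Finset.range (k * n + 1)).image (fun t : ℕ => (t : K)) ⊆ Q.roots.toFinset := by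
    intro x hx
    obtain ⟨t, ht, rfl⟩ := Finset.mem_image.1 hx
    obtain ⟨v, hv, hv0⟩ := hcon t (by simpa [Nat.lt_succ_iff] using ht)
    rw [Multiset.mem_toFinset, Polynomial.mem_roots hQ, Polynomial.IsRoot, Polynomial.eval_prod]
    exact Finset.prod_eq_zero (by simpa using hv) ((hpe t v).trans hv0)
  have h1 := Finset.card_le_card hsub
  rw [Finset.card_image_of_injective _ Nat.cast_injective, Finset.card_range] at h1
  have h2 := (Multiset.toFinset_card_le Q.roots).trans (Polynomial.card_roots' Q)
  omega

theorem exists_momentForm_injOn {s : Set (Fin n → K)} (hfin : s.Finite) {k : ℕ}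
    (hk : s.ncard ≤ k) : ∃ t ≤ k * k * n, Set.InjOn (momentForm K n t) s := by
  let D : Set (Fin n → K) := (fun p : (Fin n → K) × (Fin n → K) => p.1 - p.2) '' (s ×ˢ s) \ {0}
  have hD : D.Finite := ((hfin.prod hfin).image _).sdiff
  obtain ⟨t, ht, h⟩ := exists_momentForm_ne_zero (s := D) hD (fun v hv => hv.2) (k := k * k) (by
    refine (Set.ncard_le_ncard Set.sdiff_subset ((hfin.prod hfin).image _)).trans ?_
    refine (Set.ncard_image_le (hfin.prod hfin)).trans ?_
    rw [Set.ncard_prod]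
    exact Nat.mul_le_mul hk hk)
  refine ⟨t, ht, fun x hx y hy hxy => ?_⟩
  by_contra hne
  refine h (x - y) ⟨⟨(x, y), ⟨hx, hy⟩, rfl⟩, sub_ne_zero.2 hne⟩ ?_
  rw [map_sub, hxy, sub_self]

end Moment

section Fibres

variable {K : Type*} [Field K] {N r : ℕ}

/-- The points of `Z` over `p`. -/
def fibre (L : (Fin N → K) →ₗ[K] (Fin r → K)) (Z : Set (Fin N → K)) (p : Fin r → K) :
    Set (Fin N → K) := {v ∈ Z | L v = p}

/-- Evaluation of polynomial functions at a point of `Z`. -/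
def evalAt (Z : Set (Fin N → K)) (v : Fin N → K) (hv : v ∈ Z) : CoordRing Z →ₐ[K] K :=
  Ideal.Quotient.liftₐ (vIdeal Z) (aeval v) fun f hf => by simpa [aeval_def] using hf v hv

theorem evalAt_toFun (Z : Set (Fin N → K)) (v : Fin N → K) (hv : v ∈ Z)
    (f : MvPolynomial (Fin N) K) : evalAt Z v hv (toFun Z f) = eval v f :=
  (Ideal.Quotient.lift_mk _ _ _).trans (by simp)

theorem exists_mem_of_isIntegral [IsAlgClosed K] {Z : Set (Fin N → K)} (hZ : IsSubvariety Z)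
    {A : Type*} [CommRing A] [Algebra K A] (φ : A →ₐ[K] CoordRing Z)
    (hφ : φ.toRingHom.IsIntegral) (χ : A →ₐ[K] K) (hker : ∀ a, φ a = 0 → χ a = 0) :
    ∃ v ∈ Z, ∀ a f, φ a = toFun Z f → eval v f = χ a := by
  obtain ⟨ψ, hψ⟩ := exists_ringHom_comp_eq_of_isIntegral φ.toRingHom hφ χ.toRingHom hker
  have hψ' : ∀ a, ψ (φ a) = χ a := fun a => DFunLike.congr_fun hψ a
  let v : Fin N → K := fun j => ψ (toFun Z (X j))
  have hv : ∀ f, eval v f = ψ (toFun Z f) := by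
    intro f
    induction f using MvPolynomial.induction_on with
    | C a =>
      have h1 : toFun Z (C a) = φ (algebraMap K A a) := by
        rw [φ.commutes]
        exact (toFun Z).commutes a
      rw [eval_C, h1, hψ', χ.commutes]
      rfl
    | add p q hp hq => simp [hp, hq]
    | mul_X p i hp => simp [hp, v]
  refine ⟨v, hZ.mem fun f hf => ?_, fun a f h => ?_⟩
  · rw [hv, toFun_eq_zero_iff.2 hf, map_zero]
  · rw [hv, ← h, hψ']

theorem FiniteOn.exists_mem_of_forall [IsAlgClosed K] {L : (Fin N → K) →ₗ[K] (Fin r → K)}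
    {Z : Set (Fin N → K)} (hL : FiniteOn L Z) (hZ : IsSubvariety Z) {q : Fin r → K}
    (hq : ∀ f ∈ vIdeal (L '' Z), eval q f = 0) : ∃ v ∈ Z, L v = q := by
  obtain ⟨v, hv, h⟩ := exists_mem_of_isIntegral hZ (toCoord L Z) (RingHom.Finite.to_isIntegral hL)
    (aeval q) (fun f hf => by
      rw [toCoord_apply, toFun_eq_zero_iff] at hf
      have : f ∈ vIdeal (L '' Z) := by
        rintro _ ⟨v, hv, rfl⟩
        simpa using hf v hv
      simpa [aeval_def] using hq f this)
  refine ⟨v, hv, funext fun i => ?_⟩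
  have := h (X i) _ (toCoord_apply L Z (X i))
  simpa using this

theorem FiniteOn.isSubvariety_image [IsAlgClosed K] {L : (Fin N → K) →ₗ[K] (Fin r → K)}
    {Z : Set (Fin N → K)} (hL : FiniteOn L Z) (hZ : IsSubvariety Z) : IsSubvariety (L '' Z) :=
  isSubvariety_of_subset fun _ hq => hL.exists_mem_of_forall hZ hq

/-- The degree of the finite map `L : Z → K^r`, as the rank of the extension of
coordinate rings. -/
def projDegree (L : (Fin N → K) →ₗ[K] (Fin r → K)) (Z : Set (Fin N → K)) : ℕ :=
  @Module.finrank (MvPolynomial (Fin r) K) (CoordRing Z) _ _ (toCoord L Z).toRingHom.toAlgebra.toModule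

variable {L : (Fin N → K) →ₗ[K] (Fin r → K)} {Z : Set (Fin N → K)}

theorem evalAt_aeval (v : Fin N → K) (hv : v ∈ Z) (u : MvPolynomial (Fin N) K)
    (g : Polynomial (MvPolynomial (Fin r) K)) :
    evalAt Z v hv (g.eval₂ (toCoord L Z).toRingHom (toFun Z u)) =
      (g.map (eval (L v))).eval (eval v u) := by
  have h1 : ((evalAt Z v hv : CoordRing Z →ₐ[K] K) : CoordRing Z →+* K).comp
      (toCoord L Z).toRingHom = eval (L v) := by
    ext a
    · simp
    · exact (evalAt_toFun Z v hv _).trans (eval_pullback L _ v)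
  rw [Polynomial.eval_map, ← h1, ← evalAt_toFun Z v hv]
  exact Polynomial.hom_eval₂ g _ ((evalAt Z v hv : CoordRing Z →ₐ[K] K) : CoordRing Z →+* K) _

theorem FiniteOn.exists_minpoly (hL : FiniteOn L Z) (hI : IndepOn L Z) (hp : (vIdeal Z).IsPrime)
    (u : MvPolynomial (Fin N) K) :
    ∃ μ : Polynomial (MvPolynomial (Fin r) K), μ.Monic ∧ μ.natDegree ≤ projDegree L Z ∧
      (∀ v ∈ Z, (μ.map (eval (L v))).eval (eval v u) = 0) ∧
      (∀ g : Polynomial (MvPolynomial (Fin r) K),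
        g.eval₂ (toCoord L Z).toRingHom (toFun Z u) = 0 ↔ μ ∣ g) ∧
      (μ.natDegree = projDegree L Z → ∃ D : MvPolynomial (Fin r) K, D ≠ 0 ∧
        ∀ v ∈ Z, ∀ v' ∈ Z, L v = L v' → eval v u = eval v' u → eval (L v) D ≠ 0 → v = v') := by
  let := (toCoord L Z).toRingHom.toAlgebra
  have := isDomain_coordRing hp
  have : Module.Finite (MvPolynomial (Fin r) K) (CoordRing Z) := hL
  have : FaithfulSMul (MvPolynomial (Fin r) K) (CoordRing Z) :=
    (faithfulSMul_iff_algebraMap_injective _ _).2 hI.injective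
  have hint : IsIntegral (MvPolynomial (Fin r) K) (toFun Z u) := Algebra.IsIntegral.isIntegral _
  refine ⟨minpoly (MvPolynomial (Fin r) K) (toFun Z u), minpoly.monic hint,
    natDegree_minpoly_le_finrank _, fun v hv => ?_, fun g => ?_, fun hdeg => ?_⟩
  · rw [← evalAt_aeval v hv]
    refine (congrArg _ ?_).trans (map_zero _)
    exact minpoly.aeval (MvPolynomial (Fin r) K) (toFun Z u)
  · refine ⟨fun h => minpoly.isIntegrallyClosed_dvd hint h, ?_⟩
    rintro ⟨h, rfl⟩
    rw [Polynomial.eval₂_mul]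
    exact mul_eq_zero_of_left (minpoly.aeval (MvPolynomial (Fin r) K) (toFun Z u)) _
  · choose D hD G hG using fun j =>
      exists_smul_eq_aeval_of_natDegree_minpoly_eq (R := MvPolynomial (Fin r) K) hdeg
        (toFun Z (X j))
    refine ⟨∏ j, D j, Finset.prod_ne_zero_iff.2 fun j _ => hD j, ?_⟩
    intro v hv v' hv' hvv huu hne
    rw [map_prod] at hne
    have key : ∀ w (hw : w ∈ Z) j,
        eval (L w) (D j) * w j = ((G j).map (eval (L w))).eval (eval w u) := by
      intro w hw j
      rw [← evalAt_aeval w hw]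
      have h1 : (G j).eval₂ (toCoord L Z).toRingHom (toFun Z u) =
          toFun Z (pullback L (D j) * X j) := by
        rw [map_mul]
        exact (hG j).symm
      rw [h1, evalAt_toFun]
      simp
    funext j
    have h2 := key v hv j
    have h3 := key v' hv' j
    rw [← hvv, ← huu, ← h2] at h3
    exact (mul_left_cancel₀ (Finset.prod_ne_zero_iff.1 hne j (Finset.mem_univ j)) h3).symm

theorem ncard_values_le {μ : Polynomial (MvPolynomial (Fin r) K)} (hμ : μ.Monic)
    {u : MvPolynomial (Fin N) K} (h : ∀ v ∈ Z, (μ.map (eval (L v))).eval (eval v u) = 0)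
    (p : Fin r → K) :
    ((fun v => eval v u) '' fibre L Z p).Finite ∧
      ((fun v => eval v u) '' fibre L Z p).ncard ≤ μ.natDegree := by
  classical
  have hne : μ.map (eval p) ≠ 0 := (hμ.map _).ne_zero
  have hsub : (fun v => eval v u) '' fibre L Z p ⊆ (μ.map (eval p)).roots.toFinset := by
    rintro _ ⟨v, ⟨hv, rfl⟩, rfl⟩
    simpa [hne] using h v hv
  refine ⟨(Finset.finite_toSet _).subset hsub, ?_⟩
  refine (Set.ncard_le_ncard hsub (Finset.finite_toSet _)).trans ?_
  rw [Set.ncard_coe_finset]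
  refine (Multiset.toFinset_card_le _).trans ((Polynomial.card_roots' _).trans ?_)
  exact (hμ.natDegree_map _).le

theorem FiniteOn.finite_fibre (hL : FiniteOn L Z) (hI : IndepOn L Z) (hp : (vIdeal Z).IsPrime)
    (p : Fin r → K) : (fibre L Z p).Finite := by
  have h : ∀ j, ((fun v => eval v (X j : MvPolynomial (Fin N) K)) '' fibre L Z p).Finite := by
    intro j
    obtain ⟨μ, hμ, -, h, -⟩ := hL.exists_minpoly hI hp (X j)
    exact (ncard_values_le hμ h p).1
  refine (Set.Finite.pi' h).subset fun v hv j => ?_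
  exact ⟨v, hv, by simp⟩

/-- A function taking the largest possible number of values on one fibre separates the
points of almost all fibres. -/
theorem FiniteOn.exists_separating (hL : FiniteOn L Z) (hI : IndepOn L Z)
    (hp : (vIdeal Z).IsPrime) {u : MvPolynomial (Fin N) K} {p : Fin r → K}
    (hcard : (fibre L Z p).ncard = projDegree L Z)
    (hu : Set.InjOn (fun v => eval v u) (fibre L Z p)) :
    ∃ D : MvPolynomial (Fin r) K, D ≠ 0 ∧
      ∀ v ∈ Z, ∀ v' ∈ Z, L v = L v' → eval v u = eval v' u → eval (L v) D ≠ 0 → v = v' := by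
  obtain ⟨μ, hμ, hdeg, h, -, hD⟩ := hL.exists_minpoly hI hp u
  refine hD (le_antisymm hdeg ?_)
  rw [← hcard, ← hu.ncard_image]
  exact (ncard_values_le hμ h p).2

theorem FiniteOn.ringKrullDim_eq (hL : FiniteOn L Z) (hI : IndepOn L Z) (hp : (vIdeal Z).IsPrime) :
    ringKrullDim (MvPolynomial (Fin N) K ⧸ vIdeal Z) = (r : WithBot ℕ∞) := by
  let := (toCoord L Z).toRingHom.toAlgebra
  have := isDomain_coordRing hp
  have : Module.Finite (MvPolynomial (Fin r) K) (CoordRing Z) := hL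
  have : FaithfulSMul (MvPolynomial (Fin r) K) (CoordRing Z) :=
    (faithfulSMul_iff_algebraMap_injective _ _).2 hI.injective
  have h := ringKrullDim_eq_of_isIntegral (R := MvPolynomial (Fin r) K) (S := CoordRing Z)
  rw [MvPolynomial.ringKrullDim_of_isNoetherianRing, ringKrullDim_eq_zero_of_field] at h
  exact h.trans (by simp)

variable [CharZero K]

theorem FiniteOn.ncard_fibre_le (hL : FiniteOn L Z) (hI : IndepOn L Z) (hp : (vIdeal Z).IsPrime)
    (p : Fin r → K) : (fibre L Z p).ncard ≤ projDegree L Z := by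
  obtain ⟨t, -, ht⟩ := exists_momentForm_injOn (hL.finite_fibre hI hp p) le_rfl
  obtain ⟨μ, hμ, hdeg, h, -⟩ := hL.exists_minpoly hI hp (linPoly (momentForm K N t))
  have ht' : Set.InjOn (fun v => eval v (linPoly (momentForm K N t))) (fibre L Z p) := by
    simpa only [eval_linPoly] using ht
  rw [← ht'.ncard_image]
  exact (ncard_values_le hμ h p).2.trans hdeg

/-- Over a generic point, the fibre has as many points as the degree. -/
theorem FiniteOn.exists_ncard_fibre_eq [IsAlgClosed K] (hL : FiniteOn L Z) (hI : IndepOn L Z)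
    (hp : (vIdeal Z).IsPrime) (hZ : IsSubvariety Z) :
    ∃ c : MvPolynomial (Fin r) K, c ≠ 0 ∧
      ∀ p, eval p c ≠ 0 → (fibre L Z p).ncard = projDegree L Z := by
  classical
  let := (toCoord L Z).toRingHom.toAlgebra
  have := isDomain_coordRing hp
  have : Module.Finite (MvPolynomial (Fin r) K) (CoordRing Z) := hL
  have : FaithfulSMul (MvPolynomial (Fin r) K) (CoordRing Z) :=
    (faithfulSMul_iff_algebraMap_injective _ _).2 hI.injective
  have : CharZero (MvPolynomial (Fin r) K) :=
    charZero_of_injective_algebraMap (algebraMap K _).injective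
  obtain ⟨w, hw, c, hc, a, b, hab⟩ :=
    exists_minpoly_natDegree_eq_finrank (R := MvPolynomial (Fin r) K) (S := CoordRing Z)
  have hint : IsIntegral (MvPolynomial (Fin r) K) w := Algebra.IsIntegral.isIntegral _
  have hmonic := minpoly.monic hint
  obtain ⟨u, rfl⟩ := toFun_surjective Z w
  refine ⟨c, hc, fun p hpc => le_antisymm (hL.ncard_fibre_le hI hp p) ?_⟩
  set μ := minpoly (MvPolynomial (Fin r) K) (toFun Z u)
  have hsep : (μ.map (eval p)).Separable := by
    have h1 := congrArg (Polynomial.map (eval p)) hab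
    simp only [Polynomial.map_add, Polynomial.map_mul, Polynomial.map_C,
      ← Polynomial.derivative_map] at h1
    refine ⟨Polynomial.C (eval p c)⁻¹ * a.map (eval p), Polynomial.C (eval p c)⁻¹ * b.map (eval p),
      ?_⟩
    rw [mul_assoc, mul_assoc, ← mul_add, h1, ← Polynomial.C_mul, inv_mul_cancel₀ hpc,
      Polynomial.C_1]
  have hcard : (μ.map (eval p)).roots.toFinset.card = projDegree L Z := by
    rw [Multiset.toFinset_card_of_nodup (Polynomial.nodup_roots hsep),
      IsAlgClosed.card_roots_eq_natDegree, hmonic.natDegree_map, hw]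
    rfl
  have hlift : ∀ τ ∈ (μ.map (eval p)).roots.toFinset, ∃ v ∈ fibre L Z p, eval v u = τ := by
    intro τ hτ
    have hτ' : (μ.map (eval p)).eval τ = 0 := by
      simpa [(hmonic.map (eval p)).ne_zero] using hτ
    let φ : Polynomial (MvPolynomial (Fin r) K) →ₐ[K] CoordRing Z :=
      { Polynomial.eval₂RingHom (toCoord L Z).toRingHom (toFun Z u) with
        commutes' := fun x => (Polynomial.eval₂_C _ _).trans ((toCoord L Z).commutes x) }
    let χ : Polynomial (MvPolynomial (Fin r) K) →ₐ[K] K :=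
      { Polynomial.eval₂RingHom (eval p) τ with
        commutes' := fun x => (Polynomial.eval₂_C _ _).trans (eval_C x) }
    obtain ⟨v, hv, h⟩ := exists_mem_of_isIntegral hZ φ
      (RingHom.IsIntegral.tower_top Polynomial.C φ.toRingHom (by
        have : φ.toRingHom.comp Polynomial.C = (toCoord L Z).toRingHom :=
          RingHom.ext fun x => Polynomial.eval₂_C _ _
        rw [this]
        exact RingHom.Finite.to_isIntegral hL)) χ
      (fun g hg => by
        obtain ⟨k, rfl⟩ := minpoly.isIntegrallyClosed_dvd hint hg
        change Polynomial.eval₂ (eval p) τ (μ * k) = 0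
        rw [Polynomial.eval₂_mul, ← Polynomial.eval_map, hτ', zero_mul])
    refine ⟨v, ⟨hv, funext fun i => ?_⟩, ?_⟩
    · have h1 := h (Polynomial.C (X i)) (pullback L (X i)) (Polynomial.eval₂_C _ _)
      rw [eval_pullback, eval_X] at h1
      rw [h1]
      exact (Polynomial.eval₂_C _ _).trans (eval_X i)
    · rw [h Polynomial.X u (Polynomial.eval₂_X _ _)]
      exact Polynomial.eval₂_X _ _
  have hsub : ((μ.map (eval p)).roots.toFinset : Set K) ⊆
      (fun v => eval v u) '' fibre L Z p := hlift
  rw [← hcard, ← Set.ncard_coe_finset]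
  exact (Set.ncard_le_ncard hsub ((hL.finite_fibre hI hp p).image _)).trans
    (Set.ncard_image_le (hL.finite_fibre hI hp p))

end Fibres

section Growth

theorem le_of_mul_le_mul_shift {f : ℕ → ℕ} {a b c r : ℕ} (h0 : 1 ≤ f 0)
    (hf : ∀ t, f t ≤ (t + 1) ^ r) (h : ∀ t, a * f t ≤ b * f (t + c)) : a ≤ b := by
  by_contra! hab
  have hpow : ∀ k, a ^ k * f 0 ≤ b ^ k * f (k * c) := by
    intro k
    induction k with
    | zero => simp
    | succ k ih =>
      calc a ^ (k + 1) * f 0 = a * (a ^ k * f 0) := by ring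
        _ ≤ a * (b ^ k * f (k * c)) := Nat.mul_le_mul_left _ ih
        _ = b ^ k * (a * f (k * c)) := by ring
        _ ≤ b ^ k * (b * f (k * c + c)) := Nat.mul_le_mul_left _ (h _)
        _ = b ^ (k + 1) * f ((k + 1) * c) := by rw [add_mul, one_mul]; ring
  rcases Nat.eq_zero_or_pos b with rfl | hb
  · have := h 0
    simp only [zero_mul] at this
    nlinarith
  have hb' : (0 : ℝ) < b := by exact_mod_cast hb
  have hR : (1 : ℝ) < a / b := by
    rw [one_lt_div hb']
    exact_mod_cast hab
  have hlim := tendsto_pow_const_div_const_pow_of_one_lt r hR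
  have hev := (hlim.eventually (gt_mem_nhds (show (0 : ℝ) < ((c + 1 : ℝ) ^ r)⁻¹ by positivity))).and
    (Filter.eventually_ge_atTop 1)
  obtain ⟨k, hk, hk1⟩ := hev.exists
  have hRk : (0 : ℝ) < (a / b : ℝ) ^ k := by positivity
  rw [div_lt_iff₀ hRk, inv_mul_eq_div, lt_div_iff₀ (by positivity), ← mul_pow] at hk
  have h1 : a ^ k ≤ b ^ k * (k * (c + 1)) ^ r := by
    calc a ^ k ≤ a ^ k * f 0 := Nat.le_mul_of_pos_right _ h0
      _ ≤ b ^ k * f (k * c) := hpow k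
      _ ≤ b ^ k * (k * c + 1) ^ r := Nat.mul_le_mul_left _ (hf _)
      _ ≤ b ^ k * (k * (c + 1)) ^ r := by
        refine Nat.mul_le_mul_left _ (Nat.pow_le_pow_left ?_ _)
        nlinarith
  have h2 : ((a : ℝ) / b) ^ k ≤ ((k : ℝ) * (c + 1)) ^ r := by
    rw [div_pow, div_le_iff₀ (by positivity), mul_comm]
    exact_mod_cast h1
  linarith

theorem finrank_restrictTotalDegree_le (K : Type*) [Field K] (r t : ℕ) :
    Module.finrank K (restrictTotalDegree (Fin r) K t) ≤ (t + 1) ^ r := by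
  refine (Submodule.finrank_mono (restrictTotalDegree_le_restrictDegree _ _ t)).trans ?_
  rw [restrictDegree, Module.finrank_eq_nat_card_basis
    (basisRestrictSupport K {n : Fin r →₀ ℕ | ∀ i, n i ≤ t})]
  have hinj : Function.Injective
      (fun (n : {n : Fin r →₀ ℕ | ∀ i, n i ≤ t}) (i : Fin r) =>
        (⟨n.1 i, Nat.lt_succ_of_le (n.2 i)⟩ : Fin (t + 1))) := by
    intro x y hxy
    ext i
    simpa using congrArg (fun g => (g i : ℕ)) hxy
  simpa using Nat.card_le_card_of_injective _ hinj

theorem one_le_finrank_restrictTotalDegree (K : Type*) [Field K] (r t : ℕ) :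
    1 ≤ Module.finrank K (restrictTotalDegree (Fin r) K t) := by
  have : Nontrivial (restrictTotalDegree (Fin r) K t) :=
    ⟨⟨⟨1, by simp [mem_restrictTotalDegree]⟩, 0, by simp [Subtype.ext_iff]⟩⟩
  exact Module.finrank_pos

end Growth

section Invariance

variable {K : Type*} [Field K] [CharZero K] {N r : ℕ}
  {L : (Fin N → K) →ₗ[K] (Fin r → K)} {Z : Set (Fin N → K)}

theorem FiniteOn.exists_linearIndependent_pow (hL : FiniteOn L Z) (hI : IndepOn L Z)
    (hp : (vIdeal Z).IsPrime) :
    ∃ z : MvPolynomial (Fin N) K,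
      (∀ q : Fin (projDegree L Z) → MvPolynomial (Fin r) K,
        (∀ v ∈ Z, ∑ i, eval (L v) (q i) * eval v z ^ (i : ℕ) = 0) → q = 0) ∧
      ∀ f : MvPolynomial (Fin N) K, ∃ D : MvPolynomial (Fin r) K, D ≠ 0 ∧
        ∃ q : Fin (projDegree L Z) → MvPolynomial (Fin r) K, ∀ v ∈ Z,
          eval (L v) D * eval v f = ∑ i, eval (L v) (q i) * eval v z ^ (i : ℕ) := by
  let := (toCoord L Z).toRingHom.toAlgebra
  have := isDomain_coordRing hp
  have : Module.Finite (MvPolynomial (Fin r) K) (CoordRing Z) := hL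
  have : FaithfulSMul (MvPolynomial (Fin r) K) (CoordRing Z) :=
    (faithfulSMul_iff_algebraMap_injective _ _).2 hI.injective
  have : CharZero (MvPolynomial (Fin r) K) :=
    charZero_of_injective_algebraMap (algebraMap K _).injective
  obtain ⟨w, hw, -⟩ :=
    exists_minpoly_natDegree_eq_finrank (R := MvPolynomial (Fin r) K) (S := CoordRing Z)
  have hint : IsIntegral (MvPolynomial (Fin r) K) w := Algebra.IsIntegral.isIntegral _
  obtain ⟨z, rfl⟩ := toFun_surjective Z w
  have hδ : projDegree L Z = (minpoly (MvPolynomial (Fin r) K) (toFun Z z)).natDegree := hw.symm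
  rw [hδ]
  have hsum : ∀ k (q : Fin k → MvPolynomial (Fin r) K),
      ∑ i, q i • toFun Z z ^ (i : ℕ) = toFun Z (∑ i, pullback L (q i) * z ^ (i : ℕ)) := by
    intro k q
    rw [map_sum]
    refine Finset.sum_congr rfl fun i _ => ?_
    rw [map_mul, map_pow]
    rfl
  refine ⟨z, fun q hq => ?_, fun f => ?_⟩
  · refine eq_zero_of_sum_smul_pow_minpoly (R := MvPolynomial (Fin r) K) hint q ?_
    rw [hsum, toFun_eq_zero_iff]
    intro v hv
    simpa using hq v hv
  · obtain ⟨D, hD, G, hG⟩ := 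
      exists_smul_eq_aeval_of_natDegree_minpoly_eq (R := MvPolynomial (Fin r) K) hw (toFun Z f)
    have hmod := Polynomial.aeval_modByMonic_eq_self_of_root (p := G)
      (minpoly.aeval (MvPolynomial (Fin r) K) (toFun Z z))
    set μ := minpoly (MvPolynomial (Fin r) K) (toFun Z z)
    refine ⟨D, hD, fun i => (G %ₘ μ).coeff i, fun v hv => ?_⟩
    have h1 : Polynomial.aeval (toFun Z z) (G %ₘ μ) =
        ∑ i : Fin μ.natDegree, (G %ₘ μ).coeff i • toFun Z z ^ (i : ℕ) := by
      rw [Polynomial.aeval_eq_sum_range' (n := μ.natDegree), Finset.sum_range]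
      refine Polynomial.natDegree_modByMonic_lt _ (minpoly.monic hint) ?_
      exact minpoly.ne_one (MvPolynomial (Fin r) K) (toFun Z z)
    rw [hmod, ← hG, hsum] at h1
    have h2 : toFun Z (pullback L D * f) = _ := (map_mul _ _ _).trans h1
    simpa using toFun_eq_iff.1 h2 v hv

theorem NoetherOn.exists_denominator [IsAlgClosed K] (hL : NoetherOn L Z) (hI : IndepOn L Z)
    (hp : (vIdeal Z).IsPrime) (hZ : IsCone Z) (hZc : IsSubvariety Z) :
    ∃ (z : MvPolynomial (Fin N) K) (D : MvPolynomial (Fin r) K) (c : ℕ), D ≠ 0 ∧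
      ∀ f : MvPolynomial (Fin N) K, ∃ q : Fin (projDegree L Z) → MvPolynomial (Fin r) K,
        (∀ i, (q i).totalDegree ≤ f.totalDegree + c) ∧ ∀ v ∈ Z,
          eval (L v) D * eval v f = ∑ i, eval (L v) (q i) * eval v z ^ (i : ℕ) := by
  obtain ⟨k, B, hB⟩ := hL.exists_generators hZ hZc
  obtain ⟨z, -, hz⟩ := (hL.finiteOn hZ hZc).exists_linearIndependent_pow hI hp
  choose D hD a ha using fun j => hz (B j)
  let E : Fin k → MvPolynomial (Fin r) K := fun j => ∏ j' ∈ Finset.univ.erase j, D j'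
  have hE : ∀ j, E j * D j = ∏ j', D j' := fun j =>
    Finset.prod_erase_mul _ _ (Finset.mem_univ j)
  refine ⟨z, ∏ j, D j, ∑ j, ∑ i, (E j * a j i).totalDegree,
    Finset.prod_ne_zero_iff.2 fun j _ => hD j, fun f => ?_⟩
  obtain ⟨q, hq, hqf⟩ := hB f
  refine ⟨fun i => ∑ j, q j * (E j * a j i), fun i => ?_, fun v hv => ?_⟩
  · refine totalDegree_finsetSum_le fun j _ => (totalDegree_mul _ _).trans ?_
    refine add_le_add (hq j) ?_
    refine le_trans ?_ (Finset.single_le_sum (f := fun j => ∑ i, (E j * a j i).totalDegree)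
      (fun _ _ => Nat.zero_le _) (Finset.mem_univ j))
    exact Finset.single_le_sum (f := fun i => (E j * a j i).totalDegree)
      (fun _ _ => Nat.zero_le _) (Finset.mem_univ i)
  · rw [hqf v hv, Finset.mul_sum]
    simp only [map_sum, map_mul, Finset.sum_mul]
    rw [Finset.sum_comm]
    refine Finset.sum_congr rfl fun j _ => ?_
    have h1 : ∑ i, eval (L v) (q j) * (eval (L v) (E j) * eval (L v) (a j i)) *
        eval v z ^ (i : ℕ) = eval (L v) (q j) * eval (L v) (E j) *
          ∑ i, eval (L v) (a j i) * eval v z ^ (i : ℕ) := by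
      rw [Finset.mul_sum]
      exact Finset.sum_congr rfl fun i _ => by ring
    rw [h1, ← ha j v hv, ← hE j, map_mul]
    ring

/-- The degree of a linear projection of a cone does not depend on the projection. -/
theorem projDegree_le_projDegree [IsAlgClosed K] {L' : (Fin N → K) →ₗ[K] (Fin r → K)}
    (hL : NoetherOn L Z) (hI : IndepOn L Z) (hL' : NoetherOn L' Z) (hI' : IndepOn L' Z)
    (hp : (vIdeal Z).IsPrime) (hZ : IsCone Z) (hZc : IsSubvariety Z) :
    projDegree L' Z ≤ projDegree L Z := by
  obtain ⟨z, D, c, hD, hz⟩ := hL.exists_denominator hI hp hZ hZc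
  obtain ⟨z', hz', -⟩ := (hL'.finiteOn hZ hZc).exists_linearIndependent_pow hI' hp
  have := isDomain_coordRing hp
  set δ := projDegree L Z
  set δ' := projDegree L' Z
  refine le_of_mul_le_mul_shift (f := fun t => Module.finrank K (restrictTotalDegree (Fin r) K t))
    (c := δ' * z'.totalDegree + c) (one_le_finrank_restrictTotalDegree K r 0)
    (finrank_restrictTotalDegree_le K r) fun t => ?_
  let V := fun s => restrictTotalDegree (Fin r) K s
  let Φ : (Fin δ' → V t) →ₗ[K] CoordRing Z :=
    (LinearMap.mulLeft K (toCoord L Z D)) ∘ₗ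
      ∑ i : Fin δ', (LinearMap.mulRight K (toFun Z (z' ^ (i : ℕ)))) ∘ₗ
        (toCoord L' Z).toLinearMap ∘ₗ (V t).subtype ∘ₗ LinearMap.proj i
  let Ψ : (Fin δ → V (t + (δ' * z'.totalDegree + c))) →ₗ[K] CoordRing Z :=
      ∑ i : Fin δ, (LinearMap.mulRight K (toFun Z (z ^ (i : ℕ)))) ∘ₗ
        (toCoord L Z).toLinearMap ∘ₗ (V (t + (δ' * z'.totalDegree + c))).subtype ∘ₗ
          LinearMap.proj i
  have hΦ : ∀ q, Φ q = toFun Z (pullback L D *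
      ∑ i, pullback L' (q i : MvPolynomial (Fin r) K) * z' ^ (i : ℕ)) := by
    intro q
    simp [Φ, toCoord_apply, Finset.mul_sum]
  have hΨ : ∀ q, Ψ q = toFun Z (∑ i, pullback L (q i : MvPolynomial (Fin r) K) * z ^ (i : ℕ)) := by
    intro q
    simp [Ψ, toCoord_apply]
  have hinj : Function.Injective Φ := by
    refine (injective_iff_map_eq_zero _).2 fun q hq => ?_
    rw [hΦ, map_mul, mul_eq_zero] at hq
    have h1 := hq.resolve_left fun h => hD (hI.injective (h.trans (map_zero _).symm))
    rw [toFun_eq_zero_iff] at h1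
    have h2 := hz' (fun i => (q i : MvPolynomial (Fin r) K)) fun v hv => by
      simpa using h1 v hv
    exact funext fun i => Subtype.ext (congrFun h2 i)
  have hrange : LinearMap.range Φ ≤ LinearMap.range Ψ := by
    rintro _ ⟨q, rfl⟩
    obtain ⟨p, hp, hpf⟩ := hz (∑ i, pullback L' (q i : MvPolynomial (Fin r) K) * z' ^ (i : ℕ))
    have hdeg : (∑ i, pullback L' (q i : MvPolynomial (Fin r) K) * z' ^ (i : ℕ)).totalDegree ≤
        t + δ' * z'.totalDegree := by
      refine totalDegree_finsetSum_le fun i _ => (totalDegree_mul _ _).trans (add_le_add ?_ ?_)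
      · exact (totalDegree_pullback_le _ _).trans ((mem_restrictTotalDegree _ _ _).1 (q i).2)
      · exact (totalDegree_pow _ _).trans (Nat.mul_le_mul_right _ i.2.le)
    refine ⟨fun i => ⟨p i, (mem_restrictTotalDegree _ _ _).2 ((hp i).trans ?_)⟩, ?_⟩
    · omega
    · rw [hΨ, hΦ, toFun_eq_iff]
      intro v hv
      have := hpf v hv
      simp only [map_mul, map_sum, map_pow, eval_pullback] at this ⊢
      exact this.symm
  have hfin : ∀ s, Module.Finite K (V s) := fun s =>
    inferInstanceAs (Module.Finite K (restrictTotalDegree (Fin r) K s))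
  have h1 := LinearMap.finrank_range_of_inj hinj
  have h2 := Submodule.finrank_mono hrange
  have h3 := LinearMap.finrank_range_le Ψ
  rw [h1] at h2
  have h4 := h2.trans h3
  rw [Module.finrank_pi_fintype, Module.finrank_pi_fintype] at h4
  simpa [V] using h4

end Invariance

section Lines

variable {K : Type*} [Field K] {N r s : ℕ}

theorem exists_eq_span_of_mem_linesIn {S : Set (Fin N → K)} {l : Submodule K (Fin N → K)}
    (hl : l ∈ linesIn S) : ∃ w ∈ S, w ≠ 0 ∧ l = Submodule.span K {w} := by
  obtain ⟨w, hw⟩ := finrank_eq_one_iff'.1 hl.1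
  have hw0 : (w : Fin N → K) ≠ 0 := by simpa using hw.1
  refine ⟨w, (hl.2 w.2).resolve_right hw0, hw0, le_antisymm (fun x hx => ?_) ?_⟩
  · obtain ⟨c, hc⟩ := hw.2 ⟨x, hx⟩
    exact Submodule.mem_span_singleton.2 ⟨c, congrArg Subtype.val hc⟩
  · exact (Submodule.span_singleton_le_iff_mem _ _).2 w.2

theorem span_mem_linesIn {S : Set (Fin N → K)} (hS : IsCone S) {w : Fin N → K} (hw : w ∈ S)
    (hw0 : w ≠ 0) : Submodule.span K {w} ∈ linesIn S := by
  refine ⟨finrank_span_singleton hw0, fun x hx => ?_⟩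
  obtain ⟨c, rfl⟩ := Submodule.mem_span_singleton.1 hx
  exact Or.inl (hS c w hw)

theorem IsCone.inter_submodule {S : Set (Fin N → K)} (hS : IsCone S)
    (U : Submodule K (Fin N → K)) : IsCone (S ∩ U) :=
  fun t v hv => ⟨hS t v hv.1, U.smul_mem t hv.2⟩

theorem IsCone.image {S : Set (Fin N → K)} (hS : IsCone S)
    (L : (Fin N → K) →ₗ[K] (Fin r → K)) : IsCone (L '' S) := by
  rintro t _ ⟨v, hv, rfl⟩
  exact ⟨t • v, hS t v hv, map_smul L t v⟩

/-- The projective points of `Z` over the projective point `p` are the points of the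
fibre over `p`. -/
theorem linesIn_comap_span_eq {L : (Fin N → K) →ₗ[K] (Fin r → K)} {Z : Set (Fin N → K)}
    (hL : NoetherOn L Z) (hZ : IsCone Z) {p : Fin r → K} (hp : p ≠ 0) :
    linesIn (Z ∩ ((Submodule.span K {p}).comap L : Submodule K (Fin N → K))) =
      (fun v => Submodule.span K {v}) '' fibre L Z p := by
  ext l
  constructor
  · intro hl
    obtain ⟨w, ⟨hwZ, hwU⟩, hw0, rfl⟩ := exists_eq_span_of_mem_linesIn hl
    obtain ⟨c, hc⟩ := Submodule.mem_span_singleton.1 (Submodule.mem_comap.1 hwU)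
    have hc0 : c ≠ 0 := by
      rintro rfl
      exact hw0 (hL w hwZ (by rw [← hc, zero_smul]))
    refine ⟨c⁻¹ • w, ⟨hZ _ _ hwZ, ?_⟩, ?_⟩
    · rw [map_smul, ← hc, smul_smul, inv_mul_cancel₀ hc0, one_smul]
    · exact Submodule.span_singleton_smul_eq (IsUnit.mk0 _ (inv_ne_zero hc0)) w
  · rintro ⟨v, ⟨hv, hvp⟩, rfl⟩
    refine span_mem_linesIn (hZ.inter_submodule _) ⟨hv, ?_⟩ ?_
    · exact Submodule.mem_comap.2 (by rw [hvp]; exact Submodule.mem_span_singleton_self p)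
    · rintro rfl
      exact hp (by rw [← hvp, map_zero])

theorem injOn_span_fibre {L : (Fin N → K) →ₗ[K] (Fin r → K)} {Z : Set (Fin N → K)}
    {p : Fin r → K} (hp : p ≠ 0) :
    Set.InjOn (fun v => Submodule.span K {v}) (fibre L Z p) := by
  rintro v ⟨-, hv⟩ w ⟨-, hw⟩ hvw
  have h1 : w ∈ Submodule.span K {v} := by
    change Submodule.span K {v} = Submodule.span K {w} at hvw
    rw [hvw]
    exact Submodule.mem_span_singleton_self w
  obtain ⟨c, rfl⟩ := Submodule.mem_span_singleton.1 h1
  rw [map_smul, hv] at hw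
  have h2 : (c - 1) • p = 0 := by rw [sub_smul, hw, one_smul, sub_self]
  rw [sub_eq_zero.1 ((smul_eq_zero.1 h2).resolve_right hp), one_smul]

theorem ncard_linesIn_comap_span {L : (Fin N → K) →ₗ[K] (Fin r → K)} {Z : Set (Fin N → K)}
    (hL : NoetherOn L Z) (hZ : IsCone Z) {p : Fin r → K} (hp : p ≠ 0) :
    (linesIn (Z ∩ ((Submodule.span K {p}).comap L : Submodule K (Fin N → K)))).ncard =
      (fibre L Z p).ncard := by
  rw [linesIn_comap_span_eq hL hZ hp, (injOn_span_fibre hp).ncard_image]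

/-- A projection which is finite on `Z` and separates the points of one fibre having `e` points
preserves the degree `e`. -/
theorem HasDeg.image {π : (Fin N → K) →ₗ[K] (Fin s → K)} {ρ : (Fin s → K) →ₗ[K] (Fin r → K)}
    {Z : Set (Fin N → K)} {e : ℕ} (he : HasDeg Z e) (hL : NoetherOn (ρ ∘ₗ π) Z) (hZ : IsCone Z)
    (hfin : ∀ q, (fibre (ρ ∘ₗ π) Z q).Finite) {p : Fin r → K} (hp : p ≠ 0)
    (hcard : (fibre (ρ ∘ₗ π) Z p).ncard = e) (hinj : Set.InjOn π (fibre (ρ ∘ₗ π) Z p)) :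
    HasDeg (π '' Z) e := by
  refine ⟨fun U hU => ?_, (Submodule.span K {p}).comap ρ, ?_⟩
  · have hsurj : linesIn (π '' Z ∩ U) ⊆
        (fun l => l.map π) '' linesIn (Z ∩ (U.comap π : Submodule K (Fin N → K))) := by
      intro l hl
      obtain ⟨_, ⟨⟨v, hv, rfl⟩, hvU⟩, hv0, rfl⟩ := exists_eq_span_of_mem_linesIn hl
      refine ⟨Submodule.span K {v}, span_mem_linesIn (hZ.inter_submodule _) ⟨hv, hvU⟩ ?_, ?_⟩
      · rintro rfl
        exact hv0 (map_zero π)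
      · simp [Submodule.map_span]
    have hfinl : (linesIn (Z ∩ (U.comap π : Submodule K (Fin N → K)))).Finite := by
      choose! w hw hw0 hwl using fun l (hl : l ∈ linesIn (π '' Z ∩ U)) =>
        exists_eq_span_of_mem_linesIn hl
      refine (hU.biUnion fun l _ => (hfin (ρ (w l))).image fun v => Submodule.span K {v}).subset ?_
      intro l hl
      obtain ⟨v, ⟨hv, hvU⟩, hv0, rfl⟩ := exists_eq_span_of_mem_linesIn hl
      have hπv : π v ≠ 0 := fun h => hv0 (hL v hv (by simp [h]))
      have hl' : Submodule.span K {π v} ∈ linesIn (π '' Z ∩ U) :=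
        span_mem_linesIn ((hZ.image π).inter_submodule U) ⟨⟨v, hv, rfl⟩, hvU⟩ hπv
      have hmem : w (Submodule.span K {π v}) ∈ Submodule.span K {π v} :=
        (hwl _ hl').ge (Submodule.mem_span_singleton_self _)
      obtain ⟨c, hc⟩ := Submodule.mem_span_singleton.1 hmem
      have hc0 : c ≠ 0 := by
        rintro rfl
        exact hw0 _ hl' (by rw [← hc, zero_smul])
      refine Set.mem_biUnion hl' ⟨c • v, ⟨hZ c v hv, ?_⟩, ?_⟩
      · rw [LinearMap.comp_apply, map_smul, hc]
      · exact Submodule.span_singleton_smul_eq (IsUnit.mk0 c hc0) v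
    exact (Set.ncard_le_ncard hsurj (hfinl.image _)).trans
      ((Set.ncard_image_le hfinl).trans (he.1 _ hfinl))
  · have hρ : NoetherOn ρ (π '' Z) := by
      rintro _ ⟨v, hv, rfl⟩ h
      rw [hL v hv h, map_zero]
    have hfib : fibre ρ (π '' Z) p = π '' fibre (ρ ∘ₗ π) Z p := by
      ext w
      constructor
      · rintro ⟨⟨v, hv, rfl⟩, h⟩
        exact ⟨v, ⟨hv, h⟩, rfl⟩
      · rintro ⟨v, ⟨hv, h⟩, rfl⟩
        exact ⟨⟨v, hv, rfl⟩, h⟩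
    refine ⟨?_, ?_⟩
    · rw [linesIn_comap_span_eq hρ (hZ.image π) hp, hfib]
      exact ((hfin p).image _).image _
    · rw [ncard_linesIn_comap_span hρ (hZ.image π) hp, hfib, hinj.ncard_image, hcard]

end Lines

section Elimination

variable {K : Type*} [Field K] {N k : ℕ}

/-- The linear map with first component `l` and remaining components given by `M`. -/
def consMap (l : (Fin N → K) →ₗ[K] K) (M : (Fin N → K) →ₗ[K] (Fin k → K)) :
    (Fin N → K) →ₗ[K] (Fin (k + 1) → K) :=
  LinearMap.pi (Fin.cons l fun i => LinearMap.proj i ∘ₗ M)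

theorem consMap_apply (l : (Fin N → K) →ₗ[K] K) (M : (Fin N → K) →ₗ[K] (Fin k → K))
    (v : Fin N → K) : consMap l M v = (Fin.cons (l v) (M v) : Fin (k + 1) → K) := by
  ext i
  refine Fin.cases ?_ (fun j => ?_) i <;> simp [consMap]

theorem consMap_eq_zero {l : (Fin N → K) →ₗ[K] K} {M : (Fin N → K) →ₗ[K] (Fin k → K)}
    {v : Fin N → K} : consMap l M v = 0 ↔ l v = 0 ∧ M v = 0 := by
  rw [consMap_apply, funext_iff, Fin.forall_fin_succ]
  simp [funext_iff]

theorem exists_linearMap_ker_eq {V : Type*} [AddCommGroup V] [Module K V] [FiniteDimensional K V]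
    (U : Submodule K V) :
    ∃ M : V →ₗ[K] (Fin (Module.finrank K (V ⧸ U)) → K), LinearMap.ker M = U := by
  let e : (V ⧸ U) ≃ₗ[K] (Fin (Module.finrank K (V ⧸ U)) → K) :=
    LinearEquiv.ofFinrankEq _ _ (by simp)
  exact ⟨e.toLinearMap ∘ₗ U.mkQ, by rw [LinearEquiv.ker_comp, Submodule.ker_mkQ]⟩

/-- A hypersurface equation for the image of `Z`, not divisible by the first variable. -/
theorem exists_homogeneous_eval_ne_zero [Infinite K] {l : (Fin N → K) →ₗ[K] K}
    {M : (Fin N → K) →ₗ[K] (Fin k → K)} {Z : Set (Fin N → K)} (hZ : IsCone Z)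
    (hp : (vIdeal Z).IsPrime) (hl : ∃ v ∈ Z, l v ≠ 0) (hI : ¬ IndepOn (consMap l M) Z) :
    ∃ (f : MvPolynomial (Fin (k + 1)) K) (e : ℕ), f.IsHomogeneous e ∧
      (∀ v ∈ Z, eval (consMap l M v) f = 0) ∧
      ∃ c : Fin k → K, c ≠ 0 ∧ eval (Fin.cons 0 c : Fin (k + 1) → K) f ≠ 0 := by
  have hex : ∃ a, ∃ f : MvPolynomial (Fin (k + 1)) K, f ≠ 0 ∧ f.totalDegree = a ∧
      f ∈ vIdeal (consMap l M '' Z) := by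
    simp only [IndepOn, not_forall] at hI
    obtain ⟨f, hf, hf0⟩ := hI
    exact ⟨_, f, hf0, rfl, by rintro _ ⟨v, hv, rfl⟩; exact hf v hv⟩
  classical
  obtain ⟨f, hf0, hfa, hf⟩ := Nat.find_spec hex
  have hmin : ∀ g : MvPolynomial (Fin (k + 1)) K, g ≠ 0 → g ∈ vIdeal (consMap l M '' Z) →
      Nat.find hex ≤ g.totalDegree := fun g hg0 hg => Nat.find_min' hex ⟨g, hg0, rfl, hg⟩
  set a := Nat.find hex
  have hcone := hZ.image (consMap l M)
  obtain ⟨e, he⟩ : ∃ e, homogeneousComponent e f ≠ 0 := by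
    by_contra! h
    apply hf0
    rw [← sum_homogeneousComponent f]
    exact Finset.sum_eq_zero fun i _ => h i
  have hge := homogeneousComponent_isHomogeneous e f
  have hgv := homogeneousComponent_mem_vIdeal hcone hf e
  have hga : (homogeneousComponent e f).totalDegree ≤ a := by
    rw [hge.totalDegree he, ← hfa]
    by_contra! h
    exact he (homogeneousComponent_eq_zero _ _ h)
  set g := homogeneousComponent e f
  refine ⟨g, e, hge, fun v hv => hgv _ ⟨v, hv, rfl⟩, ?_⟩
  obtain ⟨v₀, hv₀, hlv₀⟩ := hl
  have hc : ∃ c : Fin k → K, eval (Fin.cons 0 c : Fin (k + 1) → K) g ≠ 0 := by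
    by_contra! h
    have hcoeff : (finSuccEquiv K k g).coeff 0 = 0 := by
      refine MvPolynomial.funext fun c => ?_
      have h1 := h c
      rw [eval_eq_eval_mv_eval', ← Polynomial.coeff_zero_eq_eval_zero, Polynomial.coeff_map] at h1
      rw [h1, map_zero]
    obtain ⟨q, hq⟩ := Polynomial.X_dvd_iff.2 hcoeff
    have hgq : g = X 0 * (finSuccEquiv K k).symm q := by
      apply (finSuccEquiv K k).injective
      rw [map_mul, AlgEquiv.apply_symm_apply, hq, finSuccEquiv_X_zero]
    set g' := (finSuccEquiv K k).symm q
    have hg' : g' ≠ 0 := by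
      intro h
      exact he (by rw [hgq, h, mul_zero])
    have hvan : g' ∈ vIdeal (consMap l M '' Z) := by
      have h1 : pullback (consMap l M) (X 0) * pullback (consMap l M) g' ∈ vIdeal Z := by
        rw [← map_mul, ← hgq]
        intro v hv
        rw [eval_pullback]
        exact hgv _ ⟨v, hv, rfl⟩
      rcases hp.mem_or_mem h1 with h2 | h2
      · have := h2 v₀ hv₀
        simp [consMap_apply, hlv₀] at this
      · rintro _ ⟨v, hv, rfl⟩
        simpa using h2 v hv
    have h3 := hmin g' hg' hvan
    have h4 : g.totalDegree = 1 + g'.totalDegree := by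
      rw [hgq, totalDegree_mul_of_isDomain (X_ne_zero 0) hg', totalDegree_X]
    omega
  obtain ⟨c, hc⟩ := hc
  refine ⟨c, ?_, hc⟩
  rintro rfl
  have h0 : (Fin.cons 0 0 : Fin (k + 1) → K) = (0 : K) • consMap l M v₀ := by
    rw [zero_smul]
    ext i
    refine Fin.cases ?_ (fun j => ?_) i <;> simp
  exact hc (by rw [h0]; exact hgv _ (hcone 0 _ ⟨v₀, hv₀, rfl⟩))

/-- Noether normalisation keeping the first form: a base point free system can be cut down to
an algebraically independent one. -/
theorem NoetherOn.exists_indepOn [Infinite K] {l : (Fin N → K) →ₗ[K] K} {Z : Set (Fin N → K)}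
    (hZ : IsCone Z) (hp : (vIdeal Z).IsPrime) (hl : ∃ v ∈ Z, l v ≠ 0)
    (M : (Fin N → K) →ₗ[K] (Fin k → K)) (hM : NoetherOn (consMap l M) Z) :
    ∃ (k' : ℕ) (T : (Fin k → K) →ₗ[K] (Fin k' → K)), NoetherOn (consMap l (T ∘ₗ M)) Z ∧
      IndepOn (consMap l (T ∘ₗ M)) Z ∧ k' ≤ k ∧ (IndepOn (consMap l M) Z ∨ k' < k) := by
  induction k using Nat.strong_induction_on with
  | _ k ih =>
  by_cases hI : IndepOn (consMap l M) Z
  · exact ⟨k, LinearMap.id, by simpa using hM, by simpa using hI, le_rfl, Or.inl hI⟩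
  obtain ⟨f, e, hf, hfZ, c, hc0, hc⟩ := exists_homogeneous_eval_ne_zero hZ hp hl hI
  obtain ⟨T, hT⟩ := exists_linearMap_ker_eq (Submodule.span K {c})
  have hlt : Module.finrank K ((Fin k → K) ⧸ Submodule.span K {c}) < k := by
    have h1 := Submodule.finrank_quotient_add_finrank (Submodule.span K {c})
    rw [finrank_span_singleton hc0, Module.finrank_fin_fun] at h1
    omega
  have hN : NoetherOn (consMap l (T ∘ₗ M)) Z := by
    intro v hv h0
    rw [consMap_eq_zero] at h0
    have h1 : M v ∈ Submodule.span K {c} := by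
      rw [← hT]
      exact h0.2
    obtain ⟨a, ha⟩ := Submodule.mem_span_singleton.1 h1
    refine hM v hv (consMap_eq_zero.2 ⟨h0.1, ?_⟩)
    by_cases ha0 : a = 0
    · rw [← ha, ha0, zero_smul]
    · exfalso
      have h2 := hfZ v hv
      have h3 : consMap l M v = a • (Fin.cons 0 c : Fin (k + 1) → K) := by
        rw [consMap_apply, h0.1, ← ha]
        ext i
        refine Fin.cases ?_ (fun j => ?_) i <;> simp
      rw [h3, eval_smul_of_isHomogeneous hf] at h2
      exact (mul_ne_zero (pow_ne_zero _ ha0) hc) h2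
  obtain ⟨k', T', h1, h2, h3, -⟩ := ih _ hlt (T ∘ₗ M) hN
  exact ⟨k', T' ∘ₗ T, h1, h2, by omega, Or.inr (by omega)⟩

end Elimination

section Degree

variable {K : Type*} [Field K] [CharZero K] [IsAlgClosed K] {N r : ℕ}
  {L : (Fin N → K) →ₗ[K] (Fin (r + 1) → K)} {Z : Set (Fin N → K)}

/-- The degree of a projective variety is the degree of any of its Noether normalisations. -/
theorem HasDeg.projDegree_eq {e : ℕ} (he : HasDeg Z e) (hL : NoetherOn L Z) (hI : IndepOn L Z)
    (hp : (vIdeal Z).IsPrime) (hZ : IsCone Z) (hZc : IsSubvariety Z) : projDegree L Z = e := by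
  have hInf : Infinite K := IsAlgClosed.instInfinite
  have hF := hL.finiteOn hZ hZc
  refine le_antisymm ?_ ?_
  · obtain ⟨c, hc0, hc⟩ := hF.exists_ncard_fibre_eq hI hp hZc
    obtain ⟨p, hpc⟩ := exists_eval_ne_zero (mul_ne_zero hc0 (X_ne_zero (R := K) (0 : Fin (r + 1))))
    rw [map_mul, eval_X] at hpc
    have hp0 : p ≠ 0 := by
      rintro rfl
      simp at hpc
    rw [← hc p (left_ne_zero_of_mul hpc), ← ncard_linesIn_comap_span hL hZ hp0]
    refine he.1 _ ?_
    rw [linesIn_comap_span_eq hL hZ hp0]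
    exact (hF.finite_fibre hI hp p).image _
  · obtain ⟨U, hU, hcard⟩ := he.2
    rcases Nat.eq_zero_or_pos e with rfl | hpos
    · exact Nat.zero_le _
    choose! w hw hw0 hwl using fun l (hl : l ∈ linesIn (Z ∩ U)) => exists_eq_span_of_mem_linesIn hl
    obtain ⟨t, -, ht⟩ := exists_momentForm_ne_zero (hU.image w)
      (by rintro _ ⟨l, hl, rfl⟩; exact hw0 l hl) le_rfl
    set l₀ := momentForm K N t
    have hl₀ : ∀ l ∈ linesIn (Z ∩ U), l₀ (w l) ≠ 0 := fun l hl => ht _ ⟨l, hl, rfl⟩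
    obtain ⟨M, hM⟩ := exists_linearMap_ker_eq U
    have hN : NoetherOn (consMap l₀ M) Z := by
      intro v hv h
      rw [consMap_eq_zero] at h
      by_contra hv0
      have hvU : v ∈ U := by
        rw [← hM]
        exact h.2
      have hl := span_mem_linesIn (hZ.inter_submodule U) ⟨hv, hvU⟩ hv0
      obtain ⟨c, hc⟩ := Submodule.mem_span_singleton.1
        ((hwl _ hl).ge (Submodule.mem_span_singleton_self _))
      refine hl₀ _ hl ?_
      rw [← hc, map_smul, h.1, smul_zero]
    obtain ⟨l₁, hl₁⟩ : (linesIn (Z ∩ U)).Nonempty := Set.nonempty_of_ncard_ne_zero (by omega)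
    obtain ⟨k', T, hN', hI', -, -⟩ := NoetherOn.exists_indepOn hZ hp
      ⟨w l₁, (hw l₁ hl₁).1, hl₀ l₁ hl₁⟩ M hN
    have hk : k' = r := by
      have h1 := hF.ringKrullDim_eq hI hp
      rw [(hN'.finiteOn hZ hZc).ringKrullDim_eq hI' hp] at h1
      have h2 : k' + 1 = r + 1 := by exact_mod_cast h1
      omega
    subst hk
    have hF' := hN'.finiteOn hZ hZc
    refine le_trans ?_ (projDegree_le_projDegree hL hI hN' hI' hp hZ hZc)
    refine le_trans ?_ (hF'.ncard_fibre_le hI' hp (Fin.cons 1 0))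
    have hfin := hF'.finite_fibre hI' hp (Fin.cons 1 0)
    rw [← hcard]
    refine (Set.ncard_le_ncard (t := (fun v => Submodule.span K {v}) '' _) ?_
      (hfin.image _)).trans (Set.ncard_image_le hfin)
    intro l hl
    have hc0 := inv_ne_zero (hl₀ l hl)
    refine ⟨(l₀ (w l))⁻¹ • w l, ⟨hZ _ _ (hw l hl).1, ?_⟩, ?_⟩
    · have hMw : M (w l) = 0 := by
        have := (hw l hl).2
        rw [← hM] at this
        exact this
      rw [map_smul, consMap_apply, LinearMap.comp_apply, hMw, map_zero]
      ext i
      refine Fin.cases ?_ (fun j => ?_) i <;> simp [hl₀ l hl]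
    · change Submodule.span K {(l₀ (w l))⁻¹ • w l} = l
      rw [Submodule.span_singleton_smul_eq (IsUnit.mk0 _ hc0)]
      exact (hwl l hl).symm

end Degree

section Cones

variable {K : Type*} [Field K] {N r : ℕ}

theorem vIdeal_image_eq_comap {φ : MvPolynomial (Fin r) K →ₐ[K] MvPolynomial (Fin N) K}
    {F : (Fin N → K) → (Fin r → K)} (h : ∀ f v, eval v (φ f) = eval (F v) f)
    (Z : Set (Fin N → K)) : vIdeal (F '' Z) = (vIdeal Z).comap φ := by
  ext f
  simp [mem_vIdeal, h]

theorem isPrime_vIdeal_image {L : (Fin N → K) →ₗ[K] (Fin r → K)} {Z : Set (Fin N → K)}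
    (hp : (vIdeal Z).IsPrime) : (vIdeal (L '' Z)).IsPrime := by
  rw [vIdeal_image_eq_comap (φ := pullback L) (fun f v => eval_pullback L f v)]
  exact hp.comap (pullback L)

theorem nonempty_of_isPrime_vIdeal {Z : Set (Fin N → K)} (hp : (vIdeal Z).IsPrime) :
    Z.Nonempty := by
  by_contra h
  rw [Set.not_nonempty_iff_eq_empty] at h
  exact hp.ne_top ((Ideal.eq_top_iff_one _).2 (by simp [mem_vIdeal, h]))

theorem IsSubvariety.zeroLocusSet_subset {S : Set (Fin N → K)} (hS : IsSubvariety S)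
    {P : Ideal (MvPolynomial (Fin N) K)} (h : vIdeal S ≤ P) :
    zeroLocusSet (P : Set (MvPolynomial (Fin N) K)) ⊆ S :=
  fun _ hx => hS.mem fun f hf => hx f (h hf)

/-- The cone generated by a set. -/
def scalarCone (W : Set (Fin N → K)) : Set (Fin N → K) := {v | ∃ c : K, ∃ w ∈ W, v = c • w}

theorem isCone_scalarCone (W : Set (Fin N → K)) : IsCone (scalarCone W) := by
  rintro t _ ⟨c, w, hw, rfl⟩
  exact ⟨t * c, w, hw, smul_smul t c w⟩

theorem subset_scalarCone (W : Set (Fin N → K)) : W ⊆ scalarCone W :=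
  fun w hw => ⟨1, w, hw, (one_smul K w).symm⟩

/-- The restriction of a polynomial to a line through the origin. -/
theorem exists_polynomial_eval_smul (f : MvPolynomial (Fin N) K) (w : Fin N → K) :
    ∃ P : Polynomial K, ∀ t, P.eval t = eval (t • w) f := by
  refine ⟨aeval (fun i => Polynomial.C (w i) * Polynomial.X) f, fun t => ?_⟩
  induction f using MvPolynomial.induction_on with
  | C a => simp
  | add p q hp hq => simp [hp, hq]
  | mul_X p i hp =>
    rw [map_mul, Polynomial.eval_mul, hp, map_mul, aeval_X, eval_X, Pi.smul_apply]
    simp [mul_comm (w i)]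

theorem isPrime_vIdeal_scalarCone [Infinite K] {W : Set (Fin N → K)} (hp : (vIdeal W).IsPrime) :
    (vIdeal (scalarCone W)).IsPrime := by
  refine ⟨fun h => hp.ne_top (top_le_iff.1 (h ▸ vIdeal_anti (subset_scalarCone W))), ?_⟩
  intro f g hfg
  by_contra! h
  simp only [mem_vIdeal, not_forall] at h
  obtain ⟨⟨_, ⟨a, v, hv, rfl⟩, hfv⟩, _, ⟨b, w, hw, rfl⟩, hgw⟩ := h
  obtain ⟨P, hP⟩ := exists_polynomial_eval_smul f v
  obtain ⟨Q, hQ⟩ := exists_polynomial_eval_smul g w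
  have hPQ : P * Q ≠ 0 := by
    refine mul_ne_zero ?_ ?_
    · rintro rfl
      exact hfv (by rw [← hP, Polynomial.eval_zero])
    · rintro rfl
      exact hgw (by rw [← hQ, Polynomial.eval_zero])
  obtain ⟨t, ht⟩ : ∃ t, (P * Q).eval t ≠ 0 := by
    by_contra! h
    exact hPQ (Polynomial.funext fun t => by simpa using h t)
  rw [Polynomial.eval_mul, hP, hQ] at ht
  let L : (Fin N → K) →ₗ[K] (Fin N → K) := t • LinearMap.id
  have hL : ∀ v, L v = t • v := fun v => rfl
  have h1 : pullback L f * pullback L g ∈ vIdeal W := by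
    intro x hx
    rw [map_mul, eval_pullback, eval_pullback, hL, ← map_mul]
    exact hfg _ ⟨t, x, hx, rfl⟩
  rcases hp.mem_or_mem h1 with h2 | h2
  · exact left_ne_zero_of_mul ht (by simpa [hL] using h2 v hv)
  · exact right_ne_zero_of_mul ht (by simpa [hL] using h2 w hw)

theorem IsCone.zeroLocusSet_vIdeal {S : Set (Fin N → K)} (hS : IsCone S) :
    IsCone (zeroLocusSet (vIdeal S : Set (MvPolynomial (Fin N) K))) := by
  intro t v hv f hf
  have h := hv (pullback (t • LinearMap.id) f) (by
    intro x hx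
    rw [eval_pullback]
    exact hf _ (hS t x hx))
  rwa [eval_pullback] at h

end Cones

section Components

variable {K : Type*} [Field K] [IsAlgClosed K] {N : ℕ}

theorem vIdeal_zeroLocusSet_of_isPrime {P : Ideal (MvPolynomial (Fin N) K)} (hP : P.IsPrime) :
    vIdeal (zeroLocusSet (P : Set (MvPolynomial (Fin N) K))) = P := by
  rw [vIdeal_eq_vanishingIdeal, zeroLocusSet_eq_zeroLocus]
  exact IsPrime.vanishingIdeal_zeroLocus P

theorem IrredComp.eq_vIdeal_of_le {S Z : Set (Fin N → K)} (hZ : IrredComp S Z)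
    {P : Ideal (MvPolynomial (Fin N) K)} (hP : P.IsPrime)
    (h1 : zeroLocusSet (P : Set (MvPolynomial (Fin N) K)) ⊆ S) (h2 : P ≤ vIdeal Z) : vIdeal Z = P := by
  have h3 := vIdeal_zeroLocusSet_of_isPrime hP
  have h4 := hZ.2.2.2.2 (zeroLocusSet (P : Set (MvPolynomial (Fin N) K))) h1 (isSubvariety_zeroLocusSet _) (h3.symm ▸ hP)
    (fun x hx f hf => h2 hf x hx)
  rw [h4, h3]

theorem finite_setOf_irredComp {S : Set (Fin N → K)} (hS : IsSubvariety S) :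
    {Z | IrredComp S Z}.Finite := by
  refine Set.Finite.of_finite_image
    ((Ideal.finite_minimalPrimes_of_isNoetherianRing _ (vIdeal S)).subset ?_) (f := vIdeal) ?_
  · rintro _ ⟨Z, hZ, rfl⟩
    refine ⟨⟨hZ.2.2.2.1, vIdeal_anti hZ.1⟩, fun P hP hPZ => ?_⟩
    exact (hZ.eq_vIdeal_of_le hP.1 (hS.zeroLocusSet_subset hP.2) hPZ).le
  · intro Z hZ Z' hZ' h
    exact hZ.2.1.eq_of_vIdeal_eq hZ'.2.1 h

theorem exists_irredComp_mem {S : Set (Fin N → K)} (hS : IsSubvariety S) {v : Fin N → K}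
    (hv : v ∈ S) : ∃ Z, IrredComp S Z ∧ v ∈ Z := by
  have hvp : (vIdeal {v}).IsPrime := by
    rw [vIdeal_eq_vanishingIdeal]
    infer_instance
  obtain ⟨P, hP, hPv⟩ := Ideal.exists_minimalPrimes_le
    (vIdeal_anti (Set.singleton_subset_iff.2 hv))
  have hPp : P.IsPrime := hP.1.1
  have h1 := vIdeal_zeroLocusSet_of_isPrime hPp
  have hmem : v ∈ zeroLocusSet (P : Set (MvPolynomial (Fin N) K)) :=
    fun f hf => hPv hf v rfl
  refine ⟨zeroLocusSet P, ⟨hS.zeroLocusSet_subset hP.1.2,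
    isSubvariety_zeroLocusSet _, ⟨v, hmem⟩, h1.symm ▸ hPp, ?_⟩, hmem⟩
  intro Z' hZ' hZ'c hZ'p hsub
  refine (isSubvariety_zeroLocusSet _).eq_of_vIdeal_eq hZ'c ?_
  have h2 := vIdeal_anti hsub
  rw [h1] at h2 ⊢
  exact le_antisymm (hP.2 ⟨hZ'p, vIdeal_anti hZ'⟩ h2) h2

theorem IrredComp.isCone {S Z : Set (Fin N → K)} (hZ : IrredComp S Z) (hS : IsSubvariety S)
    (hSc : IsCone S) : IsCone Z := by
  have hInf : Infinite K := IsAlgClosed.instInfinite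
  have h1 := hZ.eq_vIdeal_of_le (isPrime_vIdeal_scalarCone hZ.2.2.2.1)
    (hS.zeroLocusSet_subset
      (vIdeal_anti (by rintro _ ⟨c, w, hw, rfl⟩; exact hSc c w (hZ.1 hw))))
    (vIdeal_anti (subset_scalarCone Z))
  rw [hZ.2.1, h1]
  exact (isCone_scalarCone Z).zeroLocusSet_vIdeal

end Components

section ProjClosure

variable {K : Type*} [Field K] {n k : ℕ}

theorem coneOf_eq_scalarCone (X : Set (Fin n → K)) :
    coneOf X = scalarCone ((fun x => (Fin.cons 1 x : Fin (n + 1) → K)) '' X) := by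
  ext v
  constructor
  · rintro ⟨c, x, hx, rfl⟩
    exact ⟨c, _, ⟨x, hx, rfl⟩, rfl⟩
  · rintro ⟨c, _, ⟨x, hx, rfl⟩, rfl⟩
    exact ⟨c, x, hx, rfl⟩

theorem isCone_projClosure (X : Set (Fin n → K)) : IsCone (projClosure X) := by
  rw [projClosure, coneOf_eq_scalarCone]
  exact (isCone_scalarCone _).zeroLocusSet_vIdeal

theorem isSubvariety_projClosure (X : Set (Fin n → K)) : IsSubvariety (projClosure X) :=
  isSubvariety_zeroLocusSet _

/-- Setting the variable `X 0` to `1`. -/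
def dehomogenization : MvPolynomial (Fin (n + 1)) K →ₐ[K] MvPolynomial (Fin n) K :=
  aeval (Fin.cons 1 X)

theorem eval_dehomogenization (f : MvPolynomial (Fin (n + 1)) K) (x : Fin n → K) :
    eval x (dehomogenization f) = eval (Fin.cons 1 x : Fin (n + 1) → K) f := by
  induction f using MvPolynomial.induction_on with
  | C a => simp [dehomogenization]
  | add p q hp hq => rw [map_add, map_add, map_add, hp, hq]
  | mul_X p i hp =>
    rw [map_mul, map_mul, map_mul, hp, dehomogenization, aeval_X, eval_X]
    refine Fin.cases ?_ (fun j => ?_) i <;> simp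

theorem isPrime_vIdeal_projClosure [Infinite K] {X : Set (Fin n → K)} (hp : (vIdeal X).IsPrime) :
    (vIdeal (projClosure X)).IsPrime := by
  rw [projClosure, vIdeal_zeroLocusSet_vIdeal, coneOf_eq_scalarCone]
  refine isPrime_vIdeal_scalarCone ?_
  rw [vIdeal_image_eq_comap eval_dehomogenization]
  exact hp.comap _

theorem coneOf_subset_projClosure (X : Set (Fin n → K)) : coneOf X ⊆ projClosure X :=
  subset_zeroLocusSet_vIdeal _

theorem cons_mem_projClosure {X : Set (Fin n → K)} {x : Fin n → K} (hx : x ∈ X) :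
    (Fin.cons 1 x : Fin (n + 1) → K) ∈ projClosure X :=
  coneOf_subset_projClosure X ⟨1, x, hx, (one_smul _ _).symm⟩

/-- The homogenization of a polynomial by a new variable `X 0`. -/
def homogenization (f : MvPolynomial (Fin k) K) : MvPolynomial (Fin (k + 1)) K :=
  ∑ i ∈ Finset.range (f.totalDegree + 1),
    X 0 ^ (f.totalDegree - i) * rename Fin.succ (homogeneousComponent i f)

theorem eval_smul_cons_homogenization (f : MvPolynomial (Fin k) K) (c : K) (x : Fin k → K) :
    eval (c • (Fin.cons 1 x : Fin (k + 1) → K)) (homogenization f) =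
      c ^ f.totalDegree * eval x f := by
  have h0 : eval x f = ∑ i ∈ Finset.range (f.totalDegree + 1),
      eval x (homogeneousComponent i f) := by
    rw [← map_sum, sum_homogeneousComponent]
  rw [homogenization, map_sum, h0, Finset.mul_sum]
  refine Finset.sum_congr rfl fun i hi => ?_
  have h1 : (c • (Fin.cons 1 x : Fin (k + 1) → K)) ∘ Fin.succ = c • x := by
    ext j
    simp
  rw [map_mul, map_pow, eval_X, eval_rename, h1,
    eval_smul_of_isHomogeneous (homogeneousComponent_isHomogeneous i f), ← mul_assoc]
  congr 1
  rw [Pi.smul_apply, Fin.cons_zero, smul_eq_mul, mul_one, ← pow_add]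
  congr 1
  have := Finset.mem_range.1 hi
  omega

theorem eval_cons_homogenization (f : MvPolynomial (Fin k) K) (x : Fin k → K) :
    eval (Fin.cons 1 x : Fin (k + 1) → K) (homogenization f) = eval x f := by
  have := eval_smul_cons_homogenization f 1 x
  rwa [one_smul, one_pow, one_mul] at this

theorem homogenization_ne_zero [Infinite K] {f : MvPolynomial (Fin k) K} (hf : f ≠ 0) :
    homogenization f ≠ 0 := by
  obtain ⟨x, hx⟩ := exists_eval_ne_zero hf
  intro h
  exact hx (by rw [← eval_cons_homogenization, h, map_zero])

end ProjClosure

section ProjSystem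

variable {K : Type*} [Field K] {n m : ℕ}

/-- The projection `(x₀, x) ↦ x`. -/
def tailMap : (Fin (n + 1) → K) →ₗ[K] (Fin n → K) := LinearMap.funLeft K K Fin.succ

theorem tailMap_apply (v : Fin (n + 1) → K) : tailMap v = Fin.tail v := rfl

theorem eq_zero_of_tailMap_eq_zero {v : Fin (n + 1) → K} (h0 : v 0 = 0) (h : tailMap v = 0) :
    v = 0 := by
  rw [← Fin.cons_self_tail v, h0, ← tailMap_apply, h]
  ext i
  refine Fin.cases ?_ (fun j => ?_) i <;> simp

/-- The linear map `(x₀, x) ↦ (x₀, y x)`. -/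
def projSystem (y : (Fin n → K) →ₗ[K] (Fin m → K)) :
    (Fin (n + 1) → K) →ₗ[K] (Fin (m + 1) → K) :=
  consMap (LinearMap.proj 0) (y ∘ₗ tailMap)

theorem projSystem_apply (y : (Fin n → K) →ₗ[K] (Fin m → K)) (v : Fin (n + 1) → K) :
    projSystem y v = (Fin.cons (v 0) (y (tailMap v)) : Fin (m + 1) → K) :=
  consMap_apply _ _ _

theorem projSystem_cons (y : (Fin n → K) →ₗ[K] (Fin m → K)) (c : K) (x : Fin n → K) :
    projSystem y (Fin.cons c x : Fin (n + 1) → K) = (Fin.cons c (y x) : Fin (m + 1) → K) :=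
  projSystem_apply _ _

theorem projSystem_eq_zero {y : (Fin n → K) →ₗ[K] (Fin m → K)} {v : Fin (n + 1) → K} :
    projSystem y v = 0 ↔ v 0 = 0 ∧ y (tailMap v) = 0 :=
  consMap_eq_zero

theorem exists_mem_projClosure_ne_zero {X : Set (Fin n → K)} (hX : X.Nonempty) :
    ∃ v ∈ projClosure X, (LinearMap.proj 0 : (Fin (n + 1) → K) →ₗ[K] K) v ≠ 0 := by
  obtain ⟨x, hx⟩ := hX
  exact ⟨_, cons_mem_projClosure hx, by simp⟩

theorem IndepOn.of_projSystem [Infinite K] {y : (Fin n → K) →ₗ[K] (Fin m → K)}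
    {X : Set (Fin n → K)} (h : IndepOn (projSystem y) (projClosure X)) : IndepOn y X := by
  intro f hf
  by_contra hf0
  refine homogenization_ne_zero hf0 (h _ fun v hv => ?_)
  rw [← eval_pullback]
  refine hv _ ?_
  rintro _ ⟨c, x, hx, rfl⟩
  rw [eval_pullback, map_smul, projSystem_cons, eval_smul_cons_homogenization, hf x hx, mul_zero]

variable [IsAlgClosed K]

theorem NoetherOn.finiteOn_of_projSystem {y : (Fin n → K) →ₗ[K] (Fin m → K)}
    {X : Set (Fin n → K)} (h : NoetherOn (projSystem y) (projClosure X)) : FiniteOn y X := by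
  obtain ⟨k, B, hB⟩ := h.exists_generators (isCone_projClosure X) (isSubvariety_projClosure X)
  refine finiteOn_of_generators (fun i => dehomogenization (B i)) fun f => ?_
  obtain ⟨q, -, hq⟩ := hB (rename Fin.succ f)
  refine ⟨fun i => dehomogenization (q i), fun x hx => ?_⟩
  have h1 := hq _ (cons_mem_projClosure hx)
  rw [eval_rename, projSystem_cons] at h1
  simp only [eval_dehomogenization]
  rw [← h1]
  rfl

variable {X : Set (Fin n → K)}

theorem eq_of_projSystem (hp : (vIdeal X).IsPrime)
    (hdim : ringKrullDim (MvPolynomial (Fin n) K ⧸ vIdeal X) = (m : WithBot ℕ∞))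
    {k : ℕ} {y : (Fin n → K) →ₗ[K] (Fin k → K)}
    (hN : NoetherOn (projSystem y) (projClosure X))
    (hI : IndepOn (projSystem y) (projClosure X)) : k = m := by
  have hInf : Infinite K := IsAlgClosed.instInfinite
  have h1 := hN.finiteOn_of_projSystem.ringKrullDim_eq hI.of_projSystem hp
  rw [hdim] at h1
  exact_mod_cast h1.symm

theorem exists_noetherOn_projSystem (hp : (vIdeal X).IsPrime)
    (hdim : ringKrullDim (MvPolynomial (Fin n) K ⧸ vIdeal X) = (m : WithBot ℕ∞)) :
    ∃ y : (Fin n → K) →ₗ[K] (Fin m → K), NoetherOn (projSystem y) (projClosure X) := by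
  have hInf : Infinite K := IsAlgClosed.instInfinite
  have hN : NoetherOn (consMap (LinearMap.proj 0) tailMap) (projClosure X) := by
    intro v _ h
    rw [consMap_eq_zero] at h
    exact eq_zero_of_tailMap_eq_zero h.1 h.2
  obtain ⟨k, y, hy, hI, -, -⟩ := NoetherOn.exists_indepOn (isCone_projClosure X)
    (isPrime_vIdeal_projClosure hp)
    (exists_mem_projClosure_ne_zero (nonempty_of_isPrime_vIdeal hp)) tailMap hN
  obtain rfl := eq_of_projSystem hp hdim hy hI
  exact ⟨y, hy⟩

theorem NoetherOn.indepOn_projSystem {y : (Fin n → K) →ₗ[K] (Fin m → K)}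
    (hp : (vIdeal X).IsPrime)
    (hdim : ringKrullDim (MvPolynomial (Fin n) K ⧸ vIdeal X) = (m : WithBot ℕ∞))
    (hN : NoetherOn (projSystem y) (projClosure X)) : IndepOn (projSystem y) (projClosure X) := by
  have hInf : Infinite K := IsAlgClosed.instInfinite
  obtain ⟨k, T, hT, hI, hk, h⟩ := NoetherOn.exists_indepOn (isCone_projClosure X)
    (isPrime_vIdeal_projClosure hp)
    (exists_mem_projClosure_ne_zero (nonempty_of_isPrime_vIdeal hp)) (y ∘ₗ tailMap) hN
  have := eq_of_projSystem hp hdim (y := T ∘ₗ y) hT hI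
  exact h.resolve_right (by omega)

variable [CharZero K]

/-- A Noether normalisation by forms with integer coefficients of bounded size. -/
theorem exists_momentForm_noetherOn (hp : (vIdeal X).IsPrime)
    (hdim : ringKrullDim (MvPolynomial (Fin n) K ⧸ vIdeal X) = (m : WithBot ℕ∞))
    {d : ℕ} (hd : HasDegAff X d) :
    ∃ t : Fin m → ℕ, (∀ i, t i ≤ d * n) ∧
      NoetherOn (projSystem (LinearMap.pi fun i => momentForm K n (t i))) (projClosure X) := by
  have hInf : Infinite K := IsAlgClosed.instInfinite
  have hXc := isCone_projClosure X
  have hXs := isSubvariety_projClosure X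
  have hXp := isPrime_vIdeal_projClosure hp
  have key : ∀ s : Finset (Fin m), ∃ (t : Fin m → ℕ) (y : Fin m → (Fin n → K) →ₗ[K] K),
      (∀ i, t i ≤ d * n) ∧ (∀ i ∈ s, y i = momentForm K n (t i)) ∧
        NoetherOn (projSystem (LinearMap.pi y)) (projClosure X) := by
    intro s
    induction s using Finset.induction_on with
    | empty =>
      obtain ⟨y, hy⟩ := exists_noetherOn_projSystem hp hdim
      refine ⟨0, fun i => LinearMap.proj i ∘ₗ y, by simp, by simp, ?_⟩
      convert hy
      ext
      simp
    | insert j s hj ih =>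
      obtain ⟨t, y, ht, hty, hN⟩ := ih
      have hI := NoetherOn.indepOn_projSystem hp hdim hN
      have hF := hN.finiteOn hXc hXs
      set p : Fin (m + 1) → K := Fin.cons 0 (Pi.single j 1) with hpdef
      have hfin := hF.finite_fibre hI hXp p
      have hcard := hF.ncard_fibre_le hI hXp p
      rw [HasDeg.projDegree_eq hd hN hI hXp hXc hXs] at hcard
      have hp0 : p ≠ 0 := by
        intro h
        have := congrFun h j.succ
        simp [hpdef] at this
      obtain ⟨a, ha, hav⟩ := exists_momentForm_ne_zero
        (hfin.image tailMap) (k := d) (by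
          rintro _ ⟨v, ⟨-, hv⟩, rfl⟩ h
          have h0 : v 0 = 0 := by
            have := congrFun hv 0
            rwa [projSystem_apply] at this
          rw [eq_zero_of_tailMap_eq_zero h0 h, map_zero] at hv
          exact hp0 hv.symm) ((Set.ncard_image_le hfin).trans hcard)
      refine ⟨Function.update t j a, Function.update y j (momentForm K n a), fun i => ?_,
        fun i hi => ?_, ?_⟩
      · by_cases hij : i = j
        · subst hij
          simpa using ha
        · simpa [hij] using ht i
      · by_cases hij : i = j
        · subst hij
          simp
        · simpa [hij] using hty i (Finset.mem_of_mem_insert_of_ne hi hij)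
      · intro v hv h
        rw [projSystem_eq_zero] at h
        have hi : ∀ i, i ≠ j → y i (tailMap v) = 0 := fun i hij => by
          simpa [hij] using congrFun h.2 i
        have hja : momentForm K n a (tailMap v) = 0 := by simpa using congrFun h.2 j
        refine hN v hv (projSystem_eq_zero.2 ⟨h.1, ?_⟩)
        by_contra hne
        have hyj : y j (tailMap v) ≠ 0 := by
          intro h0
          refine hne (funext fun i => ?_)
          by_cases hij : i = j
          · rw [hij]
            exact h0
          · exact hi i hij
        refine hav _ ⟨(y j (tailMap v))⁻¹ • v, ⟨hXc _ _ hv, ?_⟩, rfl⟩ ?_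
        · rw [map_smul, projSystem_apply, h.1, hpdef]
          ext i
          refine Fin.cases (by simp) (fun i => ?_) i
          by_cases hij : i = j
          · subst hij
            simp [hyj]
          · simp [hi i hij, hij]
        · rw [map_smul, map_smul, hja, smul_zero]
  obtain ⟨t, y, ht, hty, hN⟩ := key Finset.univ
  refine ⟨t, ht, ?_⟩
  rwa [funext fun i => hty i (Finset.mem_univ i)] at hN

end ProjSystem

section HyperplaneSection

variable {K : Type*} [Field K] {n m : ℕ} {V : Set (Fin (n + 1) → K)}
  {Z : Set (Fin (n + 1) → K)} {y : (Fin n → K) →ₗ[K] (Fin m → K)}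

theorem isSubvariety_inter_hyperplane (hX : IsSubvariety V) :
    IsSubvariety (V ∩ {v | v 0 = 0}) := by
  have h := isSubvariety_setOf_eval (X 0 : MvPolynomial (Fin (n + 1)) K)
  simp only [eval_X] at h
  exact hX.inter h

theorem isCone_inter_hyperplane (hX : IsCone V) : IsCone (V ∩ {v | v 0 = 0}) :=
  fun t v hv => ⟨hX t v hv.1, by simp [show v 0 = 0 from hv.2]⟩

theorem IrredComp.noetherOn (hZ : IrredComp (V ∩ {v | v 0 = 0}) Z)
    (hN : NoetherOn (projSystem y) V) : NoetherOn (y ∘ₗ tailMap) Z :=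
  fun v hv h => hN v (hZ.1 hv).1 (projSystem_eq_zero.2 ⟨(hZ.1 hv).2, h⟩)

/-- A component of a hyperplane section has codimension one: the remaining forms of a
Noether normalisation stay algebraically independent on it. -/
theorem IrredComp.indepOn [IsAlgClosed K] (hZ : IrredComp (V ∩ {v | v 0 = 0}) Z) (hX : IsSubvariety V)
    (hXc : IsCone V) (hXp : (vIdeal V).IsPrime) (hN : NoetherOn (projSystem y) V)
    (hI : IndepOn (projSystem y) V) : IndepOn (y ∘ₗ tailMap) Z := by
  have hF := hN.finiteOn hXc hX
  let := (toCoord (projSystem y) V).toRingHom.toAlgebra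
  have hdom : IsDomain (CoordRing V) := isDomain_coordRing hXp
  have hint : Algebra.IsIntegral (MvPolynomial (Fin (m + 1)) K) (CoordRing V) :=
    ⟨hF.to_isIntegral⟩
  have hfaith : FaithfulSMul (MvPolynomial (Fin (m + 1)) K) (CoordRing V) :=
    (faithfulSMul_iff_algebraMap_injective _ _).2 hI.injective
  have hcl : IsIntegrallyClosed (MvPolynomial (Fin (m + 1)) K) := inferInstance
  have hmap : ∀ g, algebraMap (MvPolynomial (Fin (m + 1)) K) (CoordRing V) g =
      toFun V (pullback (projSystem y) g) := fun g => rfl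
  have hle : vIdeal V ≤ vIdeal Z := vIdeal_anti fun v hv => (hZ.1 hv).1
  have hZp := hZ.2.2.2.1
  have hsurj := toFun_surjective V
  have hker : RingHom.ker (toFun V) = vIdeal V := by
    ext f
    exact toFun_eq_zero_iff
  let Q : Ideal (CoordRing V) := (vIdeal Z).map (toFun V)
  have hQ : Q.IsPrime := Ideal.map_isPrime_of_surjective hsurj (by rwa [hker])
  have hQmem : ∀ f, toFun V f ∈ Q ↔ f ∈ vIdeal Z := by
    intro f
    rw [← Ideal.mem_comap, Ideal.comap_map_of_surjective' _ hsurj, hker, sup_eq_left.2 hle]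
  let P : Ideal (MvPolynomial (Fin (m + 1)) K) := Ideal.span {X 0}
  have hP : P.IsPrime :=
    (Ideal.span_singleton_prime (X_ne_zero _)).2 X_prime
  have hPQ : P ≤ Q.under (MvPolynomial (Fin (m + 1)) K) := by
    refine (Ideal.span_singleton_le_iff_mem _).2 (Ideal.mem_comap.2 ?_)
    rw [hmap, hQmem]
    intro v hv
    rw [eval_pullback, eval_X, projSystem_apply, Fin.cons_zero]
    exact (hZ.1 hv).2
  obtain ⟨Q', hQ'Q, hQ'p, hQ'P⟩ := 
    Ideal.exists_ideal_le_liesOver_of_le (p := P) (q := Q.under _) Q hPQ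
  have hX0 : toFun V (X 0) ∈ Q' := by
    have h1 : (X 0 : MvPolynomial (Fin (m + 1)) K) ∈ P :=
      Ideal.mem_span_singleton_self _
    rw [hQ'P.over] at h1
    change algebraMap _ _ _ ∈ Q' at h1
    rw [hmap] at h1
    convert h1 using 1
    rw [toFun_eq_iff]
    intro v hv
    rw [eval_pullback, eval_X, eval_X, projSystem_apply, Fin.cons_zero]
  have hQQ' : vIdeal Z = Q'.comap (toFun V) := by
    refine hZ.eq_vIdeal_of_le (hQ'p.comap _) (Set.subset_inter ?_ ?_) ?_
    · refine hX.zeroLocusSet_subset fun f hf => ?_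
      rw [Ideal.mem_comap, toFun_eq_zero_iff.2 hf]
      exact Q'.zero_mem
    · intro v hv
      simpa using hv (X 0) hX0
    · intro f hf
      exact (hQmem f).1 (hQ'Q hf)
  intro f hf
  have h1 : rename Fin.succ f ∈ P := by
    rw [hQ'P.over]
    change algebraMap _ _ _ ∈ Q'
    rw [hmap, ← Ideal.mem_comap, ← hQQ']
    intro v hv
    rw [eval_pullback, eval_rename, projSystem_apply]
    exact hf v hv
  obtain ⟨g, hg⟩ := Ideal.mem_span_singleton.1 h1
  have hInf : Infinite K := IsAlgClosed.instInfinite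
  refine MvPolynomial.funext fun x => ?_
  have h2 := congrArg (eval (Fin.cons 0 x : Fin (m + 1) → K)) hg
  rw [eval_rename, map_mul, eval_X, Fin.cons_zero, zero_mul] at h2
  rw [map_zero, ← h2]
  rfl

end HyperplaneSection

section Images

variable {K : Type*} [Field K] {N r s : ℕ}

theorem IndepOn.image {π : (Fin N → K) →ₗ[K] (Fin s → K)} {ρ : (Fin s → K) →ₗ[K] (Fin r → K)}
    {Z : Set (Fin N → K)} (hI : IndepOn (ρ ∘ₗ π) Z) : IndepOn ρ (π '' Z) :=
  fun f hf => hI f fun v hv => hf _ ⟨v, hv, rfl⟩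

theorem FiniteOn.image {π : (Fin N → K) →ₗ[K] (Fin s → K)} {ρ : (Fin s → K) →ₗ[K] (Fin r → K)}
    {Z : Set (Fin N → K)} (hF : FiniteOn (ρ ∘ₗ π) Z) : FiniteOn ρ (π '' Z) := by
  let := (toCoord (ρ ∘ₗ π) Z).toRingHom.toAlgebra
  let := (toCoord ρ (π '' Z)).toRingHom.toAlgebra
  have hfin : Module.Finite (MvPolynomial (Fin r) K) (CoordRing Z) := hF
  let φ : CoordRing (π '' Z) →+* CoordRing Z :=
    Ideal.Quotient.lift _ (toCoord π Z).toRingHom fun f hf =>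
      toFun_eq_zero_iff.2 fun v hv => by simpa using hf _ ⟨v, hv, rfl⟩
  have hφ : ∀ f, φ (toFun (π '' Z) f) = toFun Z (pullback π f) := fun f => rfl
  let ψ : CoordRing (π '' Z) →ₗ[MvPolynomial (Fin r) K] CoordRing Z :=
    { toFun := φ
      map_add' := map_add φ
      map_smul' := fun a b => by
        change φ (toFun (π '' Z) (pullback ρ a) * b) = toFun Z (pullback (ρ ∘ₗ π) a) * φ b
        rw [map_mul, hφ]
        congr 1
        rw [toFun_eq_iff]
        intro v _
        simp }
  have hψ : Function.Injective ψ := by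
    refine (injective_iff_map_eq_zero φ).2 fun x hx => ?_
    obtain ⟨f, rfl⟩ := toFun_surjective _ x
    rw [hφ, toFun_eq_zero_iff] at hx
    rw [toFun_eq_zero_iff]
    rintro _ ⟨v, hv, rfl⟩
    simpa using hx v hv
  exact Module.Finite.of_injective ψ hψ

theorem IndepOn.isSubvariety_inter_and_ne {L : (Fin N → K) →ₗ[K] (Fin r → K)}
    {Z : Set (Fin N → K)} (hI : IndepOn L Z) (hZ : IsSubvariety Z) {D : MvPolynomial (Fin r) K}
    (hD : D ≠ 0) : IsSubvariety (Z ∩ {v | eval (L v) D = 0}) ∧ Z ∩ {v | eval (L v) D = 0} ≠ Z := by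
  refine ⟨?_, fun h => hD (hI D fun v hv => (h.ge hv).2)⟩
  have h := isSubvariety_setOf_eval (pullback L D)
  simp only [eval_pullback] at h
  exact hZ.inter h

theorem zeroLocusSet_vIdeal_image {L : (Fin N → K) →ₗ[K] (Fin r → K)} {S : Set (Fin N → K)}
    (h : IsSubvariety (L '' zeroLocusSet (vIdeal S : Set (MvPolynomial (Fin N) K)))) :
    zeroLocusSet (vIdeal (L '' S) : Set (MvPolynomial (Fin r) K)) =
      L '' zeroLocusSet (vIdeal S : Set (MvPolynomial (Fin N) K)) := by
  have h1 : vIdeal (L '' S) =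
      vIdeal (L '' zeroLocusSet (vIdeal S : Set (MvPolynomial (Fin N) K))) := by
    rw [vIdeal_image_eq_comap (φ := pullback L) (fun f v => eval_pullback L f v),
      vIdeal_image_eq_comap (φ := pullback L) (fun f v => eval_pullback L f v),
      vIdeal_zeroLocusSet_vIdeal]
  rw [h1]
  exact h.symm

theorem coneOf_image (L : (Fin N → K) →ₗ[K] (Fin r → K)) (X : Set (Fin N → K)) :
    coneOf (L '' X) = projSystem L '' coneOf X := by
  ext v
  constructor
  · rintro ⟨c, _, ⟨x, hx, rfl⟩, rfl⟩
    exact ⟨_, ⟨c, x, hx, rfl⟩, by rw [map_smul, projSystem_cons]⟩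
  · rintro ⟨_, ⟨c, x, hx, rfl⟩, rfl⟩
    exact ⟨c, _, ⟨x, hx, rfl⟩, by rw [map_smul, projSystem_cons]⟩

theorem projClosure_image [IsAlgClosed K] {L : (Fin N → K) →ₗ[K] (Fin r → K)}
    {X : Set (Fin N → K)} (hL : NoetherOn (projSystem L) (projClosure X)) :
    projClosure (L '' X) = projSystem L '' projClosure X := by
  have h := hL.finiteOn (isCone_projClosure X) (isSubvariety_projClosure X)
  rw [projClosure, coneOf_image]
  exact zeroLocusSet_vIdeal_image (h.isSubvariety_image (isSubvariety_projClosure X))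

/-- The image of a variety under one form more than in a Noether normalisation is a hypersurface. -/
theorem FiniteOn.exists_vIdeal_image_eq_span {y : (Fin N → K) →ₗ[K] (Fin r → K)}
    {Z : Set (Fin N → K)} (hF : FiniteOn y Z) (hI : IndepOn y Z) (hp : (vIdeal Z).IsPrime)
    (z : (Fin N → K) →ₗ[K] K) : ∃ h, vIdeal (consMap z y '' Z) = Ideal.span {h} := by
  obtain ⟨μ, -, -, -, hμ, -⟩ := hF.exists_minpoly hI hp (linPoly z)
  refine ⟨(finSuccEquiv K r).symm μ, ?_⟩
  ext f
  have h1 : (finSuccEquiv K r).symm μ ∣ f ↔ μ ∣ finSuccEquiv K r f := by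
    rw [← map_dvd_iff (finSuccEquiv K r), AlgEquiv.apply_symm_apply]
  rw [Ideal.mem_span_singleton, h1, ← hμ]
  obtain ⟨g, hg⟩ := toFun_surjective Z
    ((finSuccEquiv K r f).eval₂ (toCoord y Z).toRingHom (toFun Z (linPoly z)))
  have h2 : ∀ v ∈ Z, eval v g = eval (consMap z y v) f := by
    intro v hv
    rw [← evalAt_toFun Z v hv, hg, evalAt_aeval, eval_linPoly, consMap_apply,
      eval_eq_eval_mv_eval']
  rw [← hg, toFun_eq_zero_iff]
  constructor
  · intro hf v hv
    rw [h2 v hv]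
    exact hf _ ⟨v, hv, rfl⟩
  · rintro hf _ ⟨v, hv, rfl⟩
    rw [← h2 v hv]
    exact hf v hv

theorem linesIn_eq_empty {S : Set (Fin N → K)} (hS : S ⊆ {0}) : linesIn S = ∅ := by
  refine Set.eq_empty_of_forall_notMem fun l hl => ?_
  obtain ⟨w, hw, hw0, -⟩ := exists_eq_span_of_mem_linesIn hl
  exact hw0 (hS hw)

theorem hasDeg_iff_of_subset_zero {S : Set (Fin N → K)} (hS : S ⊆ {0}) {e : ℕ} :
    HasDeg S e ↔ e = 0 := by
  have h : ∀ U : Submodule K (Fin N → K), linesIn (S ∩ U) = ∅ :=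
    fun U => linesIn_eq_empty (Set.inter_subset_left.trans hS)
  simp [HasDeg, h, eq_comm]

end Images

section LinearProjection

variable {K : Type*} [Field K] {n m : ℕ}

theorem injOn_tailMap_fibre (y : (Fin n → K) →ₗ[K] (Fin m → K)) (V : Set (Fin (n + 1) → K))
    (p : Fin (m + 1) → K) : Set.InjOn tailMap (fibre (projSystem y) V p) := by
  rintro v ⟨-, hv⟩ w ⟨-, hw⟩ h
  have h0 : v 0 = w 0 := by
    have := congrFun (hv.trans hw.symm) 0
    rwa [projSystem_apply, projSystem_apply, Fin.cons_zero, Fin.cons_zero] at this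
  rw [← Fin.cons_self_tail v, ← Fin.cons_self_tail w, h0, ← tailMap_apply, h, ← tailMap_apply]

variable {y : (Fin n → K) →ₗ[K] (Fin m → K)} {z : (Fin n → K) →ₗ[K] K}

theorem tailMap_comp_consMap (z : (Fin n → K) →ₗ[K] K) (y : (Fin n → K) →ₗ[K] (Fin m → K)) :
    tailMap ∘ₗ consMap z y = y := by
  refine LinearMap.ext fun v => ?_
  rw [LinearMap.comp_apply, consMap_apply]
  rfl

theorem tailMap_comp_projSystem {r : ℕ} (L : (Fin n → K) →ₗ[K] (Fin r → K)) :
    tailMap ∘ₗ projSystem L = L ∘ₗ tailMap := by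
  refine LinearMap.ext fun v => ?_
  rw [LinearMap.comp_apply, projSystem_apply]
  rfl

theorem projSystem_comp {r s : ℕ} (M : (Fin r → K) →ₗ[K] (Fin s → K))
    (L : (Fin n → K) →ₗ[K] (Fin r → K)) :
    projSystem M ∘ₗ projSystem L = projSystem (M ∘ₗ L) := by
  refine LinearMap.ext fun v => ?_
  rw [LinearMap.comp_apply, projSystem_apply, projSystem_apply, projSystem_apply]
  rfl

theorem NoetherOn.of_comp {N r s : ℕ} {π : (Fin N → K) →ₗ[K] (Fin s → K)}
    {ρ : (Fin s → K) →ₗ[K] (Fin r → K)} {Z : Set (Fin N → K)} (h : NoetherOn (ρ ∘ₗ π) Z) :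
    NoetherOn π Z :=
  fun v hv h0 => h v hv (by rw [LinearMap.comp_apply, h0, map_zero])

theorem tailMap_tailMap_comp_projSystem (z : (Fin n → K) →ₗ[K] K)
    (y : (Fin n → K) →ₗ[K] (Fin m → K)) :
    (tailMap ∘ₗ tailMap) ∘ₗ projSystem (consMap z y) = y ∘ₗ tailMap := by
  rw [LinearMap.comp_assoc, tailMap_comp_projSystem, ← LinearMap.comp_assoc, tailMap_comp_consMap]

theorem projSystem_tailMap_comp_projSystem (z : (Fin n → K) →ₗ[K] K)
    (y : (Fin n → K) →ₗ[K] (Fin m → K)) :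
    projSystem tailMap ∘ₗ projSystem (consMap z y) = projSystem y := by
  rw [projSystem_comp, tailMap_comp_consMap]

theorem apply_eq_of_projSystem_consMap_eq {v w : Fin (n + 1) → K}
    (h : projSystem (consMap z y) v = projSystem (consMap z y) w) :
    z (tailMap v) = z (tailMap w) := by
  have h1 := congrFun h (Fin.succ 0)
  rwa [projSystem_apply, projSystem_apply, Fin.cons_succ, Fin.cons_succ, consMap_apply,
    consMap_apply, Fin.cons_zero, Fin.cons_zero] at h1

theorem injOn_projSystem_consMap {s : Set (Fin (n + 1) → K)} (h : Set.InjOn (z ∘ tailMap) s) :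
    Set.InjOn (projSystem (consMap z y)) s :=
  fun _ hv _ hw hvw => h hv hw (apply_eq_of_projSystem_consMap_eq hvw)

end LinearProjection

section Projection

variable {K : Type*} [Field K] [IsAlgClosed K] {n m : ℕ}

variable {X : Set (Fin n → K)} {d : ℕ} {y : (Fin n → K) →ₗ[K] (Fin m → K)}
  {z : (Fin n → K) →ₗ[K] K}

theorem HasDegAff.ncard_fibre_projSystem_le [CharZero K] (hd : HasDegAff X d) (hp : (vIdeal X).IsPrime)
    (hN : NoetherOn (projSystem y) (projClosure X)) (hI : IndepOn (projSystem y) (projClosure X))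
    (p : Fin (m + 1) → K) : (tailMap '' fibre (projSystem y) (projClosure X) p).Finite ∧
      (tailMap '' fibre (projSystem y) (projClosure X) p).ncard ≤ d := by
  have hInf : Infinite K := IsAlgClosed.instInfinite
  have hF := hN.finiteOn (isCone_projClosure X) (isSubvariety_projClosure X)
  have hXp := isPrime_vIdeal_projClosure hp
  have hfin := hF.finite_fibre hI hXp p
  refine ⟨hfin.image _, (Set.ncard_image_le hfin).trans ((hF.ncard_fibre_le hI hXp p).trans ?_)⟩
  exact (HasDeg.projDegree_eq hd hN hI hXp (isCone_projClosure X)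
    (isSubvariety_projClosure X)).le

theorem HasDegAff.ncard_fibre_le [CharZero K] (hd : HasDegAff X d) (hp : (vIdeal X).IsPrime)
    (hN : NoetherOn (projSystem y) (projClosure X)) (hI : IndepOn (projSystem y) (projClosure X))
    (p : Fin m → K) : (fibre y X p).Finite ∧ (fibre y X p).ncard ≤ d := by
  obtain ⟨h1, h2⟩ := hd.ncard_fibre_projSystem_le hp hN hI (Fin.cons 1 p)
  have hsub : fibre y X p ⊆ tailMap '' fibre (projSystem y) (projClosure X) (Fin.cons 1 p) := by
    rintro x ⟨hx, hxp⟩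
    exact ⟨Fin.cons 1 x, ⟨cons_mem_projClosure hx, by rw [projSystem_cons, hxp]⟩, rfl⟩
  exact ⟨h1.subset hsub, (Set.ncard_le_ncard hsub h1).trans h2⟩

/-- One further form of bounded size which separates a general fibre of `X`, of its projective
closure, and of every component of the hyperplane section at infinity. -/
theorem exists_momentForm_separating [CharZero K] (hd : HasDegAff X d) (hX : IsSubvariety X)
    (hp : (vIdeal X).IsPrime) (hN : NoetherOn (projSystem y) (projClosure X))
    (hI : IndepOn (projSystem y) (projClosure X)) :
    ∃ t ≤ 3 * d * (3 * d) * n,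
      (∃ p, (fibre y X p).ncard = projDegree y X ∧
        Set.InjOn (momentForm K n t) (fibre y X p)) ∧
      (∃ p ≠ 0, (fibre (projSystem y) (projClosure X) p).ncard = d ∧
        Set.InjOn (momentForm K n t ∘ tailMap) (fibre (projSystem y) (projClosure X) p)) ∧
      ∀ Z, IrredComp (projClosure X ∩ {v | v 0 = 0}) Z → ∃ p, (0 < m → p ≠ 0) ∧
        (fibre (y ∘ₗ tailMap) Z p).ncard = projDegree (y ∘ₗ tailMap) Z ∧
          Set.InjOn (momentForm K n t ∘ tailMap) (fibre (y ∘ₗ tailMap) Z p) := by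
  have hInf : Infinite K := IsAlgClosed.instInfinite
  have hXc := isCone_projClosure X
  have hXs := isSubvariety_projClosure X
  have hXp := isPrime_vIdeal_projClosure hp
  have hXF := hN.finiteOn hXc hXs
  obtain ⟨c₁, hc₁, hfib₁⟩ := hN.finiteOn_of_projSystem.exists_ncard_fibre_eq hI.of_projSystem hp hX
  obtain ⟨p₁, hp₁⟩ := exists_eval_ne_zero hc₁
  obtain ⟨c₂, hc₂, hfib₂⟩ := hXF.exists_ncard_fibre_eq hI hXp hXs
  obtain ⟨p₂, hp₂⟩ := exists_eval_ne_zero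
    (mul_ne_zero hc₂ (X_ne_zero (R := K) (0 : Fin (m + 1))))
  have hcomp : ∀ Z, IrredComp (projClosure X ∩ {v | v 0 = 0}) Z →
      ∃ c : MvPolynomial (Fin m) K, c ≠ 0 ∧ ∀ p, eval p c ≠ 0 →
        (fibre (y ∘ₗ tailMap) Z p).ncard = projDegree (y ∘ₗ tailMap) Z := fun Z hZ =>
    ((hZ.noetherOn hN).finiteOn (hZ.isCone (isSubvariety_inter_hyperplane hXs)
      (isCone_inter_hyperplane hXc)) hZ.2.1).exists_ncard_fibre_eq
        (hZ.indepOn hXs hXc hXp hN hI) hZ.2.2.2.1 hZ.2.1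
  choose! c hc0 hc using hcomp
  have hfinite := finite_setOf_irredComp (isSubvariety_inter_hyperplane hXs)
  obtain ⟨p₃, hp₃⟩ := exists_eval_ne_zero (f := (∏ Z ∈ hfinite.toFinset, c Z) * ∏ i, (MvPolynomial.X i : MvPolynomial (Fin m) K))
    (mul_ne_zero (Finset.prod_ne_zero_iff.2 fun Z hZ => hc0 Z (by simpa using hZ))
      (Finset.prod_ne_zero_iff.2 fun i _ => X_ne_zero i))
  rw [map_mul, map_prod, map_prod] at hp₃
  obtain ⟨hfin₁, hcard₁⟩ := hd.ncard_fibre_le hp hN hI p₁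
  obtain ⟨hfin₂, hcard₂⟩ := hd.ncard_fibre_projSystem_le hp hN hI p₂
  obtain ⟨hfin₃, hcard₃⟩ := hd.ncard_fibre_projSystem_le hp hN hI (Fin.cons 0 p₃)
  obtain ⟨t, ht, hinj⟩ := exists_momentForm_injOn ((hfin₁.union hfin₂).union hfin₃) (k := 3 * d)
    (by
      refine (Set.ncard_union_le _ _).trans ?_
      have := Set.ncard_union_le (fibre y X p₁)
        (tailMap '' fibre (projSystem y) (projClosure X) p₂)
      omega)
  refine ⟨t, ht, ⟨p₁, hfib₁ p₁ hp₁, hinj.mono fun x hx => Or.inl (Or.inl hx)⟩,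
    ⟨p₂, ?_, ?_, ?_⟩, fun Z hZ => ⟨p₃, ?_, ?_, ?_⟩⟩
  · rintro rfl
    simp at hp₂
  · rw [hfib₂ p₂ (by rw [map_mul] at hp₂; exact left_ne_zero_of_mul hp₂)]
    exact HasDeg.projDegree_eq hd hN hI hXp hXc hXs
  · refine hinj.comp (injOn_tailMap_fibre y _ p₂) fun v hv => Or.inl (Or.inr ⟨v, hv, rfl⟩)
  · rintro hm rfl
    refine right_ne_zero_of_mul hp₃ (Finset.prod_eq_zero (Finset.mem_univ ⟨0, hm⟩) ?_)
    simp
  · exact hc Z hZ p₃ (Finset.prod_ne_zero_iff.1 (left_ne_zero_of_mul hp₃) Z (by simpa using hZ))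
  · have hsub : fibre (y ∘ₗ tailMap) Z p₃ ⊆
        fibre (projSystem y) (projClosure X) (Fin.cons 0 p₃) := by
      rintro v ⟨hv, hvp⟩
      refine ⟨(hZ.1 hv).1, ?_⟩
      rw [projSystem_apply, show v 0 = 0 from (hZ.1 hv).2, ← hvp]
      rfl
    exact hinj.comp ((injOn_tailMap_fibre y _ _).mono hsub)
      fun v hv => Or.inr ⟨v, hsub hv, rfl⟩

theorem HasDegAff.image_consMap (hd : HasDegAff X d) (hp : (vIdeal X).IsPrime)
    (hN : NoetherOn (projSystem y) (projClosure X))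
    (hI : IndepOn (projSystem y) (projClosure X)) {p : Fin (m + 1) → K} (hp0 : p ≠ 0)
    (hcard : (fibre (projSystem y) (projClosure X) p).ncard = d)
    (hinj : Set.InjOn (z ∘ tailMap) (fibre (projSystem y) (projClosure X) p)) :
    HasDegAff (consMap z y '' X) d := by
  have hInf : Infinite K := IsAlgClosed.instInfinite
  have hcomp := projSystem_tailMap_comp_projSystem z y
  have hF := hN.finiteOn (isCone_projClosure X) (isSubvariety_projClosure X)
  have hN' : NoetherOn (projSystem tailMap ∘ₗ projSystem (consMap z y)) (projClosure X) := by
    rwa [hcomp]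
  rw [HasDegAff, projClosure_image hN'.of_comp]
  refine HasDeg.image (ρ := projSystem tailMap) hd hN' (isCone_projClosure X) (fun q => ?_) hp0 ?_ ?_
  · rw [hcomp]
    exact hF.finite_fibre hI (isPrime_vIdeal_projClosure hp) q
  · rw [hcomp, hcard]
  · rw [hcomp]
    exact injOn_projSystem_consMap hinj

section Cone

variable {Z : Set (Fin (n + 1) → K)}

theorem NoetherOn.isSubvariety_image_projSystem (hZc : IsCone Z) (hZs : IsSubvariety Z)
    (hN : NoetherOn (y ∘ₗ tailMap) Z) (z : (Fin n → K) →ₗ[K] K) :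
    IsSubvariety (projSystem (consMap z y) '' Z) := by
  rw [← tailMap_tailMap_comp_projSystem z y] at hN
  exact (hN.of_comp.finiteOn hZc hZs).isSubvariety_image hZs

theorem coneDim_image_projSystem (hZc : IsCone Z) (hZs : IsSubvariety Z)
    (hZp : (vIdeal Z).IsPrime) (hN : NoetherOn (y ∘ₗ tailMap) Z) (hI : IndepOn (y ∘ₗ tailMap) Z)
    (z : (Fin n → K) →ₗ[K] K) :
    coneDim (projSystem (consMap z y) '' Z) = (m : WithBot ℕ∞) := by
  have hF := hN.finiteOn hZc hZs
  rw [← tailMap_tailMap_comp_projSystem z y] at hF hI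
  exact hF.image.ringKrullDim_eq hI.image (isPrime_vIdeal_image hZp)

theorem exists_projectively_injOn (hZc : IsCone Z) (hZs : IsSubvariety Z)
    (hZp : (vIdeal Z).IsPrime) (hN : NoetherOn (y ∘ₗ tailMap) Z) (hI : IndepOn (y ∘ₗ tailMap) Z)
    {p : Fin m → K}
    (hcard : (fibre (y ∘ₗ tailMap) Z p).ncard = projDegree (y ∘ₗ tailMap) Z)
    (hinj : Set.InjOn (z ∘ tailMap) (fibre (y ∘ₗ tailMap) Z p)) :
    ∃ Zb : Set (Fin (n + 1) → K), IsSubvariety Zb ∧ Zb ⊆ Z ∧ Zb ≠ Z ∧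
      ∀ v ∈ Z \ Zb, ∀ w ∈ Z \ Zb, projSystem (consMap z y) v ∈
        Submodule.span K {projSystem (consMap z y) w} → v ∈ Submodule.span K {w} := by
  have hF := hN.finiteOn hZc hZs
  obtain ⟨D, hD, hsep⟩ := hF.exists_separating hI hZp (u := linPoly (z ∘ₗ tailMap)) hcard
    (by simp only [eval_linPoly]; exact hinj)
  obtain ⟨h1, h2⟩ := hI.isSubvariety_inter_and_ne hZs hD
  refine ⟨_, h1, Set.inter_subset_left, h2, fun v hv w hw h => ?_⟩
  obtain ⟨a, ha⟩ := Submodule.mem_span_singleton.1 h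
  rw [← map_smul] at ha
  have hvw : v = a • w := by
    refine hsep v hv.1 _ (hZc a w hw.1) ?_ ?_ fun h0 => hv.2 ⟨hv.1, h0⟩
    · rw [← tailMap_tailMap_comp_projSystem z y, LinearMap.comp_apply, ← ha]
      rfl
    · rw [eval_linPoly, eval_linPoly]
      exact (apply_eq_of_projSystem_consMap_eq ha).symm
  exact Submodule.mem_span_singleton.2 ⟨a, hvw.symm⟩

theorem HasDeg.image_projSystem [CharZero K] {e : ℕ} (he : HasDeg Z e) (hZc : IsCone Z)
    (hZs : IsSubvariety Z)
    (hZp : (vIdeal Z).IsPrime) (hN : NoetherOn (y ∘ₗ tailMap) Z) (hI : IndepOn (y ∘ₗ tailMap) Z)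
    {p : Fin m → K} (hp0 : 0 < m → p ≠ 0)
    (hcard : (fibre (y ∘ₗ tailMap) Z p).ncard = projDegree (y ∘ₗ tailMap) Z)
    (hinj : Set.InjOn (z ∘ tailMap) (fibre (y ∘ₗ tailMap) Z p)) :
    HasDeg (projSystem (consMap z y) '' Z) e := by
  have hcomp := tailMap_tailMap_comp_projSystem z y
  rcases m with _ | m
  · have hZ0 : Z ⊆ {0} := fun v hv => hN v hv (Subsingleton.elim _ _)
    rw [hasDeg_iff_of_subset_zero hZ0] at he
    refine (hasDeg_iff_of_subset_zero ?_).2 he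
    rintro _ ⟨v, hv, rfl⟩
    rw [hZ0 hv, map_zero]
    rfl
  · rw [he.projDegree_eq hN hI hZp hZc hZs] at hcard
    refine HasDeg.image (ρ := tailMap ∘ₗ tailMap) he (by rwa [hcomp]) hZc (fun q => ?_)
      (hp0 m.succ_pos) (by rwa [hcomp]) ?_
    · rw [hcomp]
      exact (hN.finiteOn hZc hZs).finite_fibre hI hZp q
    · rw [hcomp]
      exact injOn_projSystem_consMap hinj

end Cone

end Projection

section IntegerMatrix

variable {K : Type*} [Field K] {n m : ℕ}

/-- The integer matrix whose rows are the moment forms at `a` and at the entries of `t`. -/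
def momentMatrix (n : ℕ) (a : ℕ) (t : Fin m → ℕ) : Matrix (Fin (m + 1)) (Fin n) ℤ :=
  Matrix.of fun i j => (((Fin.cons a t : Fin (m + 1) → ℕ) i ^ (j : ℕ) : ℕ) : ℤ)

theorem natAbs_momentMatrix_le {a B : ℕ} {t : Fin m → ℕ} (ha : a ≤ B) (ht : ∀ i, t i ≤ B)
    (i : Fin (m + 1)) (j : Fin n) : (momentMatrix n a t i j).natAbs ≤ (B + 1) ^ n := by
  have h : (Fin.cons a t : Fin (m + 1) → ℕ) i ≤ B + 1 := by
    refine Fin.cases ?_ (fun i => ?_) i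
    · rw [Fin.cons_zero]
      omega
    · rw [Fin.cons_succ]
      exact (ht i).trans B.le_succ
  rw [momentMatrix, Matrix.of_apply, Int.natAbs_natCast]
  exact (Nat.pow_le_pow_left h _).trans (Nat.pow_le_pow_right B.succ_pos j.2.le)

theorem sum_momentMatrix_mul (a : ℕ) (t : Fin m → ℕ) (x : Fin n → K) (i : Fin (m + 1)) :
    ∑ j, (momentMatrix n a t i j : K) * x j =
      consMap (momentForm K n a) (LinearMap.pi fun i => momentForm K n (t i)) x i := by
  rw [consMap_apply]
  refine Fin.cases ?_ (fun i => ?_) i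
  · simp [momentMatrix, momentForm_apply]
  · simp [momentMatrix, momentForm_apply]

theorem affProj_momentMatrix (a : ℕ) (t : Fin m → ℕ) :
    affProj (k := K) (momentMatrix n a t) 0 =
      consMap (momentForm K n a) (LinearMap.pi fun i => momentForm K n (t i)) := by
  funext x i
  rw [affProj, sum_momentMatrix_mul, Pi.zero_apply, Int.cast_zero, add_zero]

theorem projProj_momentMatrix (a : ℕ) (t : Fin m → ℕ) :
    projProj (k := K) (momentMatrix n a t) 0 =
      projSystem (consMap (momentForm K n a) (LinearMap.pi fun i => momentForm K n (t i))) := by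
  funext v
  rw [projSystem_apply, projProj]
  congr 1
  funext i
  rw [← sum_momentMatrix_mul, Pi.zero_apply, Int.cast_zero, zero_mul, add_zero]
  rfl

end IntegerMatrix

section Assembly

variable {K : Type*} [Field K] {n m : ℕ} {X : Set (Fin n → K)}
  {y : (Fin n → K) →ₗ[K] (Fin m → K)}

theorem exists_injOn_consMap {z : (Fin n → K) →ₗ[K] K} (hX : IsSubvariety X)
    (hp : (vIdeal X).IsPrime) (hF : FiniteOn y X) (hI : IndepOn y X) {p : Fin m → K}
    (hcard : (fibre y X p).ncard = projDegree y X) (hinj : Set.InjOn z (fibre y X p)) :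
    ∃ Xb, IsSubvariety Xb ∧ Xb ⊆ X ∧ Xb ≠ X ∧ Set.InjOn (consMap z y) (X \ Xb) := by
  obtain ⟨D, hD, hsep⟩ := hF.exists_separating hI hp (u := linPoly z) hcard
    (by simp only [eval_linPoly]; exact hinj)
  obtain ⟨h1, h2⟩ := hI.isSubvariety_inter_and_ne hX hD
  refine ⟨_, h1, Set.inter_subset_left, h2, fun v hv w hw h => ?_⟩
  rw [consMap_apply, consMap_apply, Fin.cons_inj] at h
  refine hsep v hv.1 w hw.1 h.2 ?_ fun h0 => hv.2 ⟨hv.1, h0⟩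
  rw [eval_linPoly, eval_linPoly, h.1]

theorem image_projSystem_inter_hyperplane [IsAlgClosed K] {r : ℕ} (L : (Fin n → K) →ₗ[K] (Fin r → K)) :
    projSystem L '' projClosure X ∩ {v | v 0 = 0} =
      ⋃ (Z : Set (Fin (n + 1) → K)) (_ : IrredComp (projClosure X ∩ {v | v 0 = 0}) Z),
        projSystem L '' Z := by
  have h0 (v) : projSystem L v 0 = v 0 := by rw [projSystem_apply, Fin.cons_zero]
  ext w
  simp only [Set.mem_iUnion]
  constructor
  · rintro ⟨⟨v, hv, rfl⟩, hv0⟩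
    obtain ⟨Z, hZ, hvZ⟩ := exists_irredComp_mem
      (isSubvariety_inter_hyperplane (isSubvariety_projClosure X)) ⟨hv, (h0 v).symm.trans hv0⟩
    exact ⟨Z, hZ, v, hvZ, rfl⟩
  · rintro ⟨Z, hZ, v, hv, rfl⟩
    exact ⟨⟨v, (hZ.1 hv).1, rfl⟩, (h0 v).trans (hZ.1 hv).2⟩

end Assembly

/-- Let `X ⊂ A^n` over `ℚ̄` be an integral closed affine subvariety
of dimension `m ≤ n-2` and degree `d`, with projective closure `X̄` and hyperplane
section `X₀ = X̄ ∩ H₀`. Then there are an integer matrix `A` and vector `b` with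
entries of size `O_{n,d}(1)` such that `π : x ↦ Ax + b` is birational from `X` onto its
image, has fibres of at most `d` points, `π(X)` (i.e. its closure) is an integral
hypersurface of degree `d` in `A^{m+1}`, and the induced map `π̄` is birational on each
irreducible component `X₀ᵢ` of `X₀`, with
`π̄(X̄) ∩ H₀ = π̄(X₀) = ⋃ᵢ π̄(X₀ᵢ)`, each `π̄(X₀ᵢ)` integral of dimension `m-1` and of
the same degree as `X₀ᵢ`. -/
theorem statement16 (n m d : ℕ) (hm : m + 2 ≤ n) :
    ∃ C : ℕ, 0 < C ∧
    ∀ X : Set (Fin n → AlgebraicClosure ℚ),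
      IsSubvariety X → X.Nonempty → (vIdeal X).IsPrime →
      ringKrullDim (MvPolynomial (Fin n) (AlgebraicClosure ℚ) ⧸ vIdeal X)
        = (m : WithBot ℕ∞) →
      HasDegAff X d →
      ∃ (A : Matrix (Fin (m + 1)) (Fin n) ℤ) (b : Fin (m + 1) → ℤ),
        (∀ i j, (A i j).natAbs ≤ C) ∧ (∀ i, (b i).natAbs ≤ C) ∧
        -- π is birational from X onto its image
        (∃ Xb : Set (Fin n → AlgebraicClosure ℚ), IsSubvariety Xb ∧ Xb ⊆ X ∧ Xb ≠ X ∧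
          Set.InjOn (affProj A b) (X \ Xb)) ∧
        -- fibres consist of at most d points
        (∀ v : Fin (m + 1) → AlgebraicClosure ℚ,
          {x ∈ X | affProj A b x = v}.Finite ∧
            {x ∈ X | affProj A b x = v}.ncard ≤ d) ∧
        -- the (closure of the) image is an integral hypersurface of degree d
        (vIdeal (affProj (k := AlgebraicClosure ℚ) A b '' X)).IsPrime ∧
        (∃ h : MvPolynomial (Fin (m + 1)) (AlgebraicClosure ℚ),
          vIdeal (affProj (k := AlgebraicClosure ℚ) A b '' X) = Ideal.span {h}) ∧
        ringKrullDim (MvPolynomial (Fin (m + 1)) (AlgebraicClosure ℚ) ⧸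
            vIdeal (affProj (k := AlgebraicClosure ℚ) A b '' X))
          = (m : WithBot ℕ∞) ∧
        HasDegAff (affProj (k := AlgebraicClosure ℚ) A b '' X) d ∧
        -- π̄ is birational on each irreducible component of X₀, with integral image
        -- of dimension m-1 and the same degree
        (∀ Z : Set (Fin (n + 1) → AlgebraicClosure ℚ),
          IrredComp (projClosure X ∩ {v | v 0 = 0}) Z →
          (∃ Zb : Set (Fin (n + 1) → AlgebraicClosure ℚ), IsSubvariety Zb ∧ Zb ⊆ Z ∧
            Zb ≠ Z ∧ ∀ x ∈ Z \ Zb, ∀ y ∈ Z \ Zb, x ≠ 0 → y ≠ 0 →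
              (projProj A b x ∈
                Submodule.span (AlgebraicClosure ℚ) {projProj A b y}) →
              x ∈ Submodule.span (AlgebraicClosure ℚ) {y}) ∧
          (vIdeal (projProj (k := AlgebraicClosure ℚ) A b '' Z)).IsPrime ∧
          coneDim (projProj (k := AlgebraicClosure ℚ) A b '' Z)
            = (m : WithBot ℕ∞) ∧
          ∀ e : ℕ, HasDeg Z e →
            HasDeg (zeroLocusSet (↑(vIdeal (projProj (k := AlgebraicClosure ℚ) A b '' Z)) :
              Set (MvPolynomial (Fin (m + 2)) (AlgebraicClosure ℚ)))) e) ∧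
        -- π̄(X̄) ∩ H₀ = ⋃ᵢ π̄(X₀ᵢ)
        (zeroLocusSet (↑(vIdeal (projProj (k := AlgebraicClosure ℚ) A b '' projClosure X)) :
            Set (MvPolynomial (Fin (m + 2)) (AlgebraicClosure ℚ))) ∩ {v | v 0 = 0}
          = ⋃ (Z : Set (Fin (n + 1) → AlgebraicClosure ℚ))
              (_ : IrredComp (projClosure X ∩ {v | v 0 = 0}) Z),
              zeroLocusSet (↑(vIdeal (projProj (k := AlgebraicClosure ℚ) A b '' Z)) :
                Set (MvPolynomial (Fin (m + 2)) (AlgebraicClosure ℚ)))) := by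
  set B := d * n + 3 * d * (3 * d) * n
  refine ⟨(B + 1) ^ n, pow_pos B.succ_pos n, fun X hX _ hp hdim hd => ?_⟩
  obtain ⟨t, ht, hN⟩ := exists_momentForm_noetherOn hp hdim hd
  have hI := hN.indepOn_projSystem hp hdim
  obtain ⟨a, ha, ⟨p, hcard, hinj⟩, ⟨q, hq0, hqcard, hqinj⟩, hcomp⟩ :=
    exists_momentForm_separating hd hX hp hN hI
  refine ⟨momentMatrix n a t, 0, natAbs_momentMatrix_le (ha.trans (Nat.le_add_left _ _))
    fun i => (ht i).trans (Nat.le_add_right _ _), fun i => Nat.zero_le _, ?_⟩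
  rw [affProj_momentMatrix, projProj_momentMatrix]
  set y := LinearMap.pi fun i => momentForm (AlgebraicClosure ℚ) n (t i)
  set z := momentForm (AlgebraicClosure ℚ) n a
  have hInf : Infinite (AlgebraicClosure ℚ) := IsAlgClosed.instInfinite
  have hXs := isSubvariety_projClosure X
  have hXc := isCone_projClosure X
  have hXp := isPrime_vIdeal_projClosure hp
  have hF := hN.finiteOn_of_projSystem
  have hIX := hI.of_projSystem
  have hclosed (Z) (hZ : IrredComp (projClosure X ∩ {v | v 0 = 0}) Z) :
      IsSubvariety (projSystem (consMap z y) '' Z) :=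
    (hZ.noetherOn hN).isSubvariety_image_projSystem
      (hZ.isCone (isSubvariety_inter_hyperplane hXs) (isCone_inter_hyperplane hXc)) hZ.2.1 z
  refine ⟨exists_injOn_consMap hX hp hF hIX hcard hinj, fun v => ?_, isPrime_vIdeal_image hp,
    hF.exists_vIdeal_image_eq_span hIX hp z, ?_, hd.image_consMap hp hN hI hq0 hqcard hqinj,
    fun Z hZ => ?_, ?_⟩
  · have hsub : {x ∈ X | consMap z y x = v} ⊆ fibre y X (tailMap v) := by
      rintro x ⟨hx, rfl⟩
      exact ⟨hx, (LinearMap.congr_fun (tailMap_comp_consMap z y) x).symm⟩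
    obtain ⟨hfin, hle⟩ := hd.ncard_fibre_le hp hN hI (tailMap v)
    exact ⟨hfin.subset hsub, (Set.ncard_le_ncard hsub hfin).trans hle⟩
  · rw [← tailMap_comp_consMap z y] at hF hIX
    exact hF.image.ringKrullDim_eq hIX.image (isPrime_vIdeal_image hp)
  · have hZN := hZ.noetherOn hN
    have hZI := hZ.indepOn hXs hXc hXp hN hI
    have hZc := hZ.isCone (isSubvariety_inter_hyperplane hXs) (isCone_inter_hyperplane hXc)
    have hZp := hZ.2.2.2.1
    obtain ⟨q, hq0, hqcard, hqinj⟩ := hcomp Z hZ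
    obtain ⟨Zb, h1, h2, h3, h4⟩ :=
      exists_projectively_injOn hZc hZ.2.1 hZp hZN hZI hqcard hqinj
    refine ⟨⟨Zb, h1, h2, h3, fun v hv w hw _ _ => h4 v hv w hw⟩, isPrime_vIdeal_image hZp,
      coneDim_image_projSystem hZc hZ.2.1 hZp hZN hZI z, fun e he => ?_⟩
    rw [← hclosed Z hZ]
    exact he.image_projSystem hZc hZ.2.1 hZp hZN hZI hq0 hqcard hqinj
  · have hXN : NoetherOn (projSystem (consMap z y)) (projClosure X) := by
      rw [← projSystem_tailMap_comp_projSystem z y] at hN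
      exact hN.of_comp
    rw [← (hXN.finiteOn hXc hXs).isSubvariety_image hXs, image_projSystem_inter_hyperplane]
    exact Set.iUnion₂_congr fun Z hZ => hclosed Z hZ
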